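/- arXiv:2512.10220 — 6 statements merged into one kernel-verified Lean document; each statement's English description precedes it below -/
import Mathlib

section
/- Let d ≥ 1 and n > d+1 be integers. Let Y_1, …, Y_n be i.i.d. standard Gaussian random vectors in ℝ^d, let Ŝ_n := (1/n) ∑_{i=1}^n Y_i Y_iᵀ be the empirical second-moment matrix, and let f_d(x) := (∑_{j=1}^d ψ((x−j+1)/2)) − d·log(x/2) + x·d/(x−d−1). Then the expected forward KL risk of the Gaussian covariance MLE equals E[ (1/2)(log det Ŝ_n + tr(Ŝ_n⁻¹) − d) ] = (1/2)(f_d(n) − d). -/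
open MeasureTheory ProbabilityTheory Matrix

/-- The digamma function `ψ(x) = (log Γ)'(x)`. -/
noncomputable def digamma (x : ℝ) : ℝ := deriv (fun t => Real.log (Real.Gamma t)) x

/-- `f_d(x) = ∑_{j=1}^d ψ((x-j+1)/2) - d log(x/2) + x d/(x-d-1)`. -/
noncomputable def fFun (d : ℕ) (x : ℝ) : ℝ :=
  (∑ j ∈ Finset.Icc 1 d, digamma ((x - j + 1) / 2)) - d * Real.log (x / 2)
    + x * d / (x - d - 1)

/-- The law of `n` i.i.d. standard Gaussian vectors in `ℝ^d`. -/
noncomputable def stdGaussianSample (n d : ℕ) : Measure (Fin n → Fin d → ℝ) :=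
  Measure.pi fun _ => Measure.pi fun _ => gaussianReal 0 1

/-- Empirical second-moment matrix `Ŝ_n = (1/n) ∑ Y_i Y_iᵀ`. -/
noncomputable def empSecondMoment (n d : ℕ) (Y : Fin n → Fin d → ℝ) :
    Matrix (Fin d) (Fin d) ℝ :=
  ((n : ℝ)⁻¹) • ∑ i : Fin n, vecMulVec (Y i) (Y i)

lemma pi_gauss_density {ι : Type*} [Fintype ι] :
    (Measure.pi fun _ : ι => gaussianReal 0 1) =
      (volume : Measure (ι → ℝ)).withDensity
        (fun x => ENNReal.ofReal (∏ i, gaussianPDFReal 0 1 (x i))) := by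
  refine Measure.pi_eq fun s hs => ?_
  rw [withDensity_apply _ (MeasurableSet.univ_pi hs), volume_pi, Measure.restrict_pi_pi,
    ← ofReal_integral_eq_lintegral_ofReal]
  · rw [integral_fintype_prod_eq_prod, ENNReal.ofReal_prod_of_nonneg]
    · refine Finset.prod_congr rfl fun i _ => ?_
      rw [gaussianReal_apply_eq_integral _ one_ne_zero]
    · intro i _
      exact integral_nonneg fun x => gaussianPDFReal_nonneg _ _ _
  · exact Integrable.fintype_prod fun i => (integrable_gaussianPDFReal 0 1).restrict
  · exact Filter.Eventually.of_forall fun x =>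
      Finset.prod_nonneg fun i _ => gaussianPDFReal_nonneg _ _ _

lemma gaussPDF_prod {ι : Type*} [Fintype ι] (x : ι → ℝ) :
    ∏ i, gaussianPDFReal 0 1 (x i) =
      (√(2 * Real.pi))⁻¹ ^ (Fintype.card ι) * Real.exp (-(∑ i, x i ^ 2) / 2) := by
  simp only [gaussianPDFReal, Finset.prod_mul_distrib, ← Real.exp_sum]
  simp [Finset.sum_div, Finset.sum_neg_distrib, neg_div]

lemma integral_gammaMeasure (a : ℝ) (ha : 0 < a) (f : ℝ → ℝ) :
    ∫ x, f x ∂(gammaMeasure a (1/2)) =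
      ∫ x in Set.Ioi 0, ((1/2) ^ a / Real.Gamma a) * (x ^ (a - 1) * Real.exp (-x/2) * f x) := by
  rw [gammaMeasure, integral_withDensity_eq_integral_toReal_smul]
  · rw [← integral_indicator measurableSet_Ioi]
    refine integral_congr_ae ?_
    have : ∀ᵐ x : ℝ, x ≠ 0 := by simp [ae_iff, measure_singleton]
    filter_upwards [this] with x hx
    simp only [gammaPDF, gammaPDFReal, Set.indicator, Set.mem_Ioi]
    rcases lt_or_gt_of_ne hx with h | h
    · simp [not_le.mpr h, not_lt.mpr h.le]
    · have h1 := Real.Gamma_pos_of_pos ha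
      simp only [h, h.le, if_true, smul_eq_mul]
      rw [ENNReal.toReal_ofReal (by positivity)]
      rw [show -x/2 = -(1/2*x) by ring]
      ring
  · exact (measurable_gammaPDFReal a _).ennreal_ofReal
  · exact Filter.Eventually.of_forall fun x => by simp [gammaPDF]

lemma integrable_gammaMeasure (a : ℝ) (ha : 0 < a) (f : ℝ → ℝ)
    (hf : IntegrableOn (fun x => x ^ (a - 1) * Real.exp (-x/2) * f x) (Set.Ioi 0)) :
    Integrable f (gammaMeasure a (1/2)) := by
  rw [gammaMeasure, integrable_withDensity_iff_integrable_smul']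
  · have h2 := (integrable_indicator_iff measurableSet_Ioi).2
      (hf.const_mul ((1/2) ^ a / Real.Gamma a))
    refine h2.congr ?_
    have : ∀ᵐ x : ℝ, x ≠ 0 := by simp [ae_iff, measure_singleton]
    filter_upwards [this] with x hx
    simp only [gammaPDF, gammaPDFReal, Set.indicator, Set.mem_Ioi]
    rcases lt_or_gt_of_ne hx with h | h
    · simp [not_le.mpr h, not_lt.mpr h.le]
    · have h1 := Real.Gamma_pos_of_pos ha
      simp only [h, h.le, if_true, smul_eq_mul]
      rw [ENNReal.toReal_ofReal (by positivity)]
      rw [show -x/2 = -(1/2*x) by ring]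
      ring
  · exact (measurable_gammaPDFReal a _).ennreal_ofReal
  · exact Filter.Eventually.of_forall fun x => by simp [gammaPDF]

lemma sumsq_radial {ι : Type*} [Fintype ι] [Nonempty ι] :
    ∃ K : ℝ, ∀ g : ℝ → ℝ, ∫ x, g (∑ i, x i ^ 2) ∂(Measure.pi fun _ : ι => gaussianReal 0 1)
      = K * ∫ t in Set.Ioi 0, t ^ ((Fintype.card ι : ℝ)/2 - 1) * Real.exp (-t/2) * g t := by
  have hc : 0 < Fintype.card ι := Fintype.card_pos
  refine ⟨(√(2 * Real.pi))⁻¹ ^ (Fintype.card ι) * (Fintype.card ι * 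
    (volume : Measure (EuclideanSpace ℝ ι)).real (Metric.ball 0 1) * (1/2)), fun g => ?_⟩
  rw [pi_gauss_density, integral_withDensity_eq_integral_toReal_smul]
  · have e : ∀ x : ι → ℝ, (ENNReal.ofReal (∏ i, gaussianPDFReal 0 1 (x i))).toReal •
        g (∑ i, x i ^ 2) = (√(2 * Real.pi))⁻¹ ^ (Fintype.card ι) *
        (fun r : ℝ => Real.exp (-r^2/2) * g (r^2)) ‖(WithLp.toLp 2 x : EuclideanSpace ℝ ι)‖ := by
      intro x
      rw [ENNReal.toReal_ofReal (Finset.prod_nonneg fun i _ => gaussianPDFReal_nonneg _ _ _),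
        gaussPDF_prod]
      simp only [EuclideanSpace.norm_sq_eq, Real.norm_eq_abs, sq_abs, smul_eq_mul]
      ring
    simp_rw [e]
    rw [integral_const_mul, (PiLp.volume_preserving_toLp ι).integral_comp
      (MeasurableEquiv.toLp 2 (ι → ℝ)).measurableEmbedding
      (fun z : EuclideanSpace ℝ ι => (fun r : ℝ => Real.exp (-r^2/2) * g (r^2)) ‖z‖)]
    rw [integral_fun_norm_addHaar (E := EuclideanSpace ℝ ι) volume (fun r : ℝ => Real.exp (-r^2/2) * g (r^2)), finrank_euclideanSpace]
    rw [nsmul_eq_mul, smul_eq_mul]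
    have : ∫ y in Set.Ioi (0:ℝ), y ^ (Fintype.card ι - 1) • (Real.exp (-y^2/2) * g (y^2)) =
       (1/2) * ∫ x in Set.Ioi (0:ℝ), (2 * x ^ ((2:ℝ) - 1)) • ((x ^ (2:ℝ)) ^ ((Fintype.card ι : ℝ)/2 - 1) * Real.exp (-(x ^ (2:ℝ))/2) * g (x ^ (2:ℝ))) := by
      rw [← integral_const_mul]
      refine setIntegral_congr_fun measurableSet_Ioi fun y hy => ?_
      have hy : 0 < y := hy
      have h1 : y ^ (Fintype.card ι - 1) = y ^ ((2:ℝ) - 1) * (y ^ (2:ℝ)) ^ ((Fintype.card ι : ℝ)/2 - 1) := by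
        rw [← Real.rpow_mul hy.le, ← Real.rpow_add hy, ← Real.rpow_natCast, Nat.cast_sub hc]
        congr 1; push_cast; ring
      simp only [smul_eq_mul, h1, Real.rpow_two]
      ring
    rw [this, integral_comp_rpow_Ioi_of_pos (p := 2) (g := fun t : ℝ => t ^ ((Fintype.card ι : ℝ)/2 - 1)
      * Real.exp (-t/2) * g t) (by norm_num)]
    ring
  · refine Measurable.ennreal_ofReal ?_
    exact Finset.measurable_prod _ fun i _ => (measurable_gaussianPDFReal 0 1).comp (measurable_pi_apply i)
  · exact Filter.Eventually.of_forall fun x => by simp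

lemma sumsq_law {ι : Type*} [Fintype ι] [Nonempty ι] :
    (Measure.pi fun _ : ι => gaussianReal 0 1).map (fun x => ∑ i, x i ^ 2) =
      gammaMeasure ((Fintype.card ι : ℝ)/2) (1/2) := by
  have hc : 0 < Fintype.card ι := Fintype.card_pos
  set a : ℝ := (Fintype.card ι : ℝ)/2 with ha
  have ha0 : 0 < a := by positivity
  have := isProbabilityMeasure_gammaMeasure ha0 (r := 1/2) (by norm_num)
  have hm : Measurable (fun x : ι → ℝ => ∑ i, x i ^ 2) := by fun_prop
  have : IsProbabilityMeasure ((Measure.pi fun _ : ι => gaussianReal 0 1).map (fun x => ∑ i, x i ^ 2)) :=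
    Measure.isProbabilityMeasure_map hm.aemeasurable
  obtain ⟨K, hK⟩ := sumsq_radial (ι := ι)
  have hG := Real.Gamma_pos_of_pos ha0
  have key : ∀ s, MeasurableSet s → ((Measure.pi fun _ : ι => gaussianReal 0 1).map (fun x => ∑ i, x i ^ 2)).real s
      = (K / ((1/2) ^ a / Real.Gamma a)) * (gammaMeasure a (1/2)).real s := by
    intro s hs
    rw [← integral_indicator_one hs, ← integral_indicator_one hs, integral_map hm.aemeasurable
      (by exact (measurable_one.indicator hs).aestronglyMeasurable), hK, integral_gammaMeasure a ha0,
      integral_const_mul, ← mul_assoc, div_mul_cancel₀]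
    positivity
  have h1 := key _ MeasurableSet.univ
  simp only [probReal_univ, mul_one] at h1
  rw [← h1] at key
  ext s hs
  have := key s hs
  rwa [one_mul, measureReal_eq_measureReal_iff] at this

lemma mellin_log {a : ℝ} (ha : 0 < a) :
    MellinConvergent (fun t => Real.log t • ((Real.exp (-t) : ℝ) : ℂ)) (a : ℂ) := by
  refine (mellin_hasDerivAt_of_isBigO_rpow (E := ℂ) ?_ ?_ (lt_add_one _) (b := 0) ?_ (by simpa using ha)).1
  · refine (Continuous.continuousOn ?_).locallyIntegrableOn measurableSet_Ioi
    exact Complex.continuous_ofReal.comp (Real.continuous_exp.comp continuous_neg)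
  · rw [← Asymptotics.isBigO_norm_left]
    simp_rw [Complex.norm_real, Asymptotics.isBigO_norm_left]
    simpa only [neg_one_mul] using (isLittleO_exp_neg_mul_rpow_atTop zero_lt_one _).isBigO
  · simp_rw [neg_zero, Real.rpow_zero]
    refine Asymptotics.isBigO_const_of_tendsto (?_ : Filter.Tendsto _ _ (nhds (1 : ℂ))) one_ne_zero
    rw [(by simp : (1 : ℂ) = Real.exp (-0))]
    exact (Complex.continuous_ofReal.comp (Real.continuous_exp.comp continuous_neg)).continuousWithinAt

lemma log_kernel {a t : ℝ} (ht : 0 < t) :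
    ((t ^ (a - 1) * Real.exp (-t) * Real.log t : ℝ) : ℂ) =
      (t : ℂ) ^ ((a : ℂ) - 1) * (Real.log t * Real.exp (-t)) := by
  push_cast
  rw [Complex.ofReal_cpow ht.le]
  push_cast; ring

lemma integrableOn_gamma_log {a : ℝ} (ha : 0 < a) :
    IntegrableOn (fun t => t ^ (a - 1) * Real.exp (-t) * Real.log t) (Set.Ioi 0) := by
  have h := (mellin_log ha)
  rw [MellinConvergent] at h
  have h2 : IntegrableOn (fun t : ℝ => ((t ^ (a - 1) * Real.exp (-t) * Real.log t : ℝ) : ℂ)) (Set.Ioi 0) := by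
    refine h.congr_fun (fun t ht => ?_) measurableSet_Ioi
    simp only [log_kernel (show 0 < t from ht), smul_eq_mul, Complex.real_smul]
  exact h2.re

lemma hasDerivAt_Gamma_real {a : ℝ} (ha : 0 < a) :
    HasDerivAt Real.Gamma (∫ t in Set.Ioi 0, t ^ (a - 1) * Real.exp (-t) * Real.log t) a := by
  have h := Complex.hasDerivAt_GammaIntegral (s := (a : ℂ)) (by simpa using ha)
  have h1 : HasDerivAt Complex.Gamma
      (((∫ t in Set.Ioi 0, t ^ (a - 1) * Real.exp (-t) * Real.log t : ℝ)) : ℂ) (a : ℂ) := by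
    have e : ((∫ t in Set.Ioi 0, t ^ (a - 1) * Real.exp (-t) * Real.log t : ℝ) : ℂ) =
        ∫ t : ℝ in Set.Ioi 0, (t : ℂ) ^ ((a : ℂ) - 1) * (Real.log t * Real.exp (-t)) := by
      rw [← integral_complex_ofReal]
      exact setIntegral_congr_fun measurableSet_Ioi fun t ht => log_kernel ht
    rw [e]
    refine h.congr_of_eventuallyEq ?_
    have : {z : ℂ | 0 < z.re} ∈ nhds (a : ℂ) :=
      (isOpen_lt continuous_const Complex.continuous_re).mem_nhds (by simpa using ha)
    filter_upwards [this] with z hz using Complex.Gamma_eq_integral hz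
  have h2 := h1.real_of_complex
  simpa [Complex.Gamma_ofReal] using h2

lemma digamma_eq {a : ℝ} (ha : 0 < a) :
    digamma a = (∫ t in Set.Ioi 0, t ^ (a - 1) * Real.exp (-t) * Real.log t) / Real.Gamma a := by
  exact ((hasDerivAt_Gamma_real ha).log (Real.Gamma_pos_of_pos ha).ne').deriv

lemma log_scale {a t : ℝ} (ht : 0 < t) : 
    ((2 * t) ^ (a - 1) * Real.exp (-(2 * t)/2) * Real.log (2 * t)) = 
      2 ^ (a - 1) * (t ^ (a - 1) * Real.exp (-t) * Real.log t)
       + 2 ^ (a - 1) * Real.log 2 * (Real.exp (-t) * t ^ (a - 1)) := by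
  rw [Real.mul_rpow (by norm_num) ht.le, Real.log_mul (by norm_num) ht.ne',
    show -(2*t)/2 = -t by ring]
  ring

lemma integrable_log_gamma {a : ℝ} (ha : 0 < a) :
    Integrable Real.log (gammaMeasure a (1/2)) := by
  refine integrable_gammaMeasure a ha _ ?_
  have h := (integrableOn_Ioi_comp_mul_left_iff
    (fun x => x ^ (a - 1) * Real.exp (-x/2) * Real.log x) 0 (a := 2) (by norm_num)).1 ?_
  · simpa using h
  refine IntegrableOn.congr_fun ?_ (fun t ht => (log_scale ht).symm) measurableSet_Ioi
  exact ((integrableOn_gamma_log ha).const_mul _).add ((Real.GammaIntegral_convergent ha).const_mul _)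

lemma integral_log_gamma {a : ℝ} (ha : 0 < a) :
    ∫ x, Real.log x ∂(gammaMeasure a (1/2)) = digamma a + Real.log 2 := by
  rw [integral_gammaMeasure a ha, integral_const_mul]
  have h := integral_comp_mul_left_Ioi'
    (fun x => x ^ (a - 1) * Real.exp (-x/2) * Real.log x) 0 (b := 2) (by norm_num)
  rw [mul_zero] at h
  rw [← h, setIntegral_congr_fun measurableSet_Ioi (fun t ht => log_scale ht), integral_add
    ((integrableOn_gamma_log ha).const_mul _) ((Real.GammaIntegral_convergent ha).const_mul _),
    integral_const_mul, integral_const_mul, ← Real.Gamma_eq_integral ha, digamma_eq ha]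
  have hG := (Real.Gamma_pos_of_pos ha).ne'
  have h2 : (2:ℝ) * 2 ^ (a - 1) = 2 ^ a := by
    rw [Real.rpow_sub_one (by norm_num)]; ring
  have h3 : (1/2 : ℝ) ^ a * 2 ^ a = 1 := by
    rw [← Real.mul_rpow (by norm_num) (by norm_num)]; norm_num
  generalize (∫ t in Set.Ioi 0, t ^ (a - 1) * Real.exp (-t) * Real.log t) = I
  rw [smul_eq_mul]
  calc _ = ((1/2:ℝ)^a * (2 * 2 ^ (a-1))) * (I + Real.log 2 * Real.Gamma a) / Real.Gamma a := by ring
    _ = _ := by rw [h2, h3]; field_simp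

lemma inv_kernel {a x : ℝ} (hx : 0 < x) :
    x ^ (a - 1) * Real.exp (-x/2) * x⁻¹ = x ^ ((a - 1) - 1) * Real.exp (-(1/2 * x)) := by
  rw [Real.rpow_sub_one hx.ne' (a - 1), show -x/2 = -(1/2*x) by ring]
  ring

lemma integrable_inv_gamma {a : ℝ} (ha : 1 < a) :
    Integrable (fun x => x⁻¹) (gammaMeasure a (1/2)) := by
  refine integrable_gammaMeasure a (by linarith) _ ?_
  refine IntegrableOn.congr_fun ?_ (fun t ht => (inv_kernel ht).symm) measurableSet_Ioi
  have := integrableOn_rpow_mul_exp_neg_mul_rpow (p := 1) (s := a - 1 - 1) (b := 1/2) (by linarith) (by norm_num) (by norm_num)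
  simpa using this

lemma integral_inv_gamma {a : ℝ} (ha : 1 < a) :
    ∫ x, x⁻¹ ∂(gammaMeasure a (1/2)) = 1 / (2 * (a - 1)) := by
  rw [integral_gammaMeasure a (by linarith), integral_const_mul,
    setIntegral_congr_fun measurableSet_Ioi (fun t ht => inv_kernel ht),
    Real.integral_rpow_mul_exp_neg_mul_Ioi (by linarith) (by norm_num)]
  have hG := (Real.Gamma_pos_of_pos (show 0 < a - 1 by linarith)).ne'
  have h1 := Real.Gamma_add_one (s := a - 1) (by linarith)
  rw [sub_add_cancel] at h1
  have h2 : (1/(1/2) : ℝ) ^ (a - 1) = 2 ^ a / 2 := by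
    rw [Real.rpow_sub_one (by norm_num)]; norm_num
  have h3 : (1/2 : ℝ) ^ a * 2 ^ a = 1 := by
    rw [← Real.mul_rpow (by norm_num) (by norm_num)]; norm_num
  have h4 : a - 1 ≠ 0 := by linarith
  rw [h1, h2]
  calc _ = ((1/2 : ℝ) ^ a * 2 ^ a) * (Real.Gamma (a-1) / Real.Gamma (a-1)) / (2 * (a - 1)) := by
        field_simp
    _ = _ := by rw [h3, div_self hG, one_mul]

lemma gammaMeasure_ne_zero (a : ℝ) : ∀ᵐ x ∂(gammaMeasure a (1/2)), x ≠ 0 := by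
  have : ∀ᵐ x : ℝ, x ≠ 0 := by simp [ae_iff, measure_singleton]
  exact (withDensity_absolutelyContinuous _ _).ae_le this

/-- Gram matrix of `d` vectors in `ℝ^n`. -/
noncomputable def gramM {d n : ℕ} (C : Fin d → Fin n → ℝ) : Matrix (Fin d) (Fin d) ℝ :=
  Matrix.of C * (Matrix.of C)ᵀ

/-- Projection orthogonal to the rows. -/
noncomputable def projM {d n : ℕ} (C : Fin d → Fin n → ℝ) : Matrix (Fin n) (Fin n) ℝ :=
  1 - (Matrix.of C)ᵀ * (gramM C)⁻¹ * Matrix.of C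

/-- index equivalence -/
def insEquiv {d : ℕ} (i : Fin (d + 1)) : Fin d ⊕ Unit ≃ Fin (d + 1) :=
  (Equiv.optionEquivSumPUnit.{0} (Fin d)).symm.trans (finSuccEquiv' i).symm

lemma det_gram_insert {d n : ℕ} (C : Fin d → Fin n → ℝ) (c : Fin n → ℝ) (i : Fin (d + 1))
    (h : (gramM C).det ≠ 0) :
    (gramM (i.insertNth c C : Fin (d + 1) → Fin n → ℝ)).det =
      (gramM C).det * (c ⬝ᵥ (projM C *ᵥ c)) := by
  have e : (gramM (i.insertNth c C : Fin (d + 1) → Fin n → ℝ)).submatrix (insEquiv i) (insEquiv i)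
      = fromBlocks (gramM C) (Matrix.of C * replicateCol Unit c)
        (replicateRow Unit c * (Matrix.of C)ᵀ) (replicateRow Unit c * replicateCol Unit c) := by
    ext a b
    rcases a with a | a <;> rcases b with b | b <;>
      simp [insEquiv, gramM, Matrix.mul_apply]
  rw [← det_submatrix_equiv_self (insEquiv i), e]
  let : Invertible (gramM C) := invertibleOfIsUnitDet _ (isUnit_iff_ne_zero.2 h)
  rw [det_fromBlocks₁₁, det_unique (n := Unit)]
  congr 1
  rw [invOf_eq_nonsing_inv, projM, sub_mulVec, dotProduct_sub, one_mulVec]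
  have e1 : (replicateRow Unit c * replicateCol Unit c) default default = c ⬝ᵥ c := by
    simp [Matrix.mul_apply, dotProduct]
  have e2 : (replicateRow Unit c * (of C)ᵀ * (gramM C)⁻¹ * (of C * replicateCol Unit c)) default default
      = c ⬝ᵥ (((of C)ᵀ * (gramM C)⁻¹ * of C) *ᵥ c) := by
    rw [← Matrix.mul_assoc, Matrix.mul_assoc (replicateRow Unit c), Matrix.mul_assoc (replicateRow Unit c),
      Matrix.mul_assoc (replicateRow Unit c), ← replicateCol_mulVec, ]
    simp [Matrix.mul_apply, dotProduct]
  rw [Matrix.sub_apply, e1, e2]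

lemma gramM_symm {d n : ℕ} (C : Fin d → Fin n → ℝ) : (gramM C)ᵀ = gramM C := by
  simp [gramM, transpose_mul]

lemma projM_herm {d n : ℕ} (C : Fin d → Fin n → ℝ) : (projM C).IsHermitian := by
  rw [IsHermitian, conjTranspose_eq_transpose_of_trivial]
  simp [projM, transpose_sub, transpose_mul, transpose_nonsing_inv, gramM_symm, Matrix.mul_assoc]

lemma projM_idem {d n : ℕ} (C : Fin d → Fin n → ℝ) (h : (gramM C).det ≠ 0) :
    projM C * projM C = projM C := by
  have h1 : (gramM C)⁻¹ * gramM C = 1 := nonsing_inv_mul _ (isUnit_iff_ne_zero.2 h)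
  have : ((of C)ᵀ * (gramM C)⁻¹ * of C) * ((of C)ᵀ * (gramM C)⁻¹ * of C) =
      (of C)ᵀ * (gramM C)⁻¹ * of C := by
    calc _ = (of C)ᵀ * (((gramM C)⁻¹ * (of C * (of C)ᵀ)) * (gramM C)⁻¹) * of C := by
          simp only [Matrix.mul_assoc]
      _ = _ := by
          rw [← gramM, h1, one_mul]
  simp only [projM, mul_sub, sub_mul, this, one_mul, mul_one]
  abel

lemma projM_trace {d n : ℕ} (C : Fin d → Fin n → ℝ) (h : (gramM C).det ≠ 0) :
    (projM C).trace = n - d := by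
  have h1 : gramM C * (gramM C)⁻¹ = 1 := mul_nonsing_inv _ (isUnit_iff_ne_zero.2 h)
  rw [projM, trace_sub, trace_mul_comm, ← Matrix.mul_assoc, ← gramM, h1]
  simp

lemma quad_eigen {n : ℕ} {P : Matrix (Fin n) (Fin n) ℝ} (hP : P.IsHermitian) (x : Fin n → ℝ) :
    (∑ i, x i • hP.eigenvectorBasis i).ofLp ⬝ᵥ (P *ᵥ (∑ i, x i • hP.eigenvectorBasis i).ofLp)
      = ∑ i, hP.eigenvalues i * x i ^ 2 := by
  set b := hP.eigenvectorBasis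
  have hv : P *ᵥ (∑ i, x i • b i).ofLp = (∑ i, (hP.eigenvalues i * x i) • b i).ofLp := by
    simp only [WithLp.ofLp_sum, WithLp.ofLp_smul, mulVec_sum, mulVec_smul]
    refine Finset.sum_congr rfl fun i _ => ?_
    rw [hP.mulVec_eigenvectorBasis, smul_smul, mul_comm]
  rw [hv]
  have : ∀ u v : EuclideanSpace ℝ (Fin n), u.ofLp ⬝ᵥ v.ofLp = inner ℝ u v := by
    intro u v
    simp [PiLp.inner_apply, dotProduct, mul_comm]
  rw [this, b.orthonormal.inner_sum]
  refine Finset.sum_congr rfl fun i _ => ?_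
  simp; ring

lemma idem_eigen {n : ℕ} {P : Matrix (Fin n) (Fin n) ℝ} (hP : P.IsHermitian) (h : P * P = P) (i : Fin n) :
    hP.eigenvalues i = 0 ∨ hP.eigenvalues i = 1 := by
  set v := hP.eigenvectorBasis i
  have h1 := hP.mulVec_eigenvectorBasis i
  have hv : v.ofLp ≠ 0 := by
    intro h0
    have : ‖v‖ = 1 := hP.eigenvectorBasis.orthonormal.1 i
    have h0' : v = 0 := by ext j; simp [h0]
    simp [h0'] at this
  have h2 : P *ᵥ (P *ᵥ v.ofLp) = P *ᵥ v.ofLp := by rw [mulVec_mulVec, h]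
  rw [h1, mulVec_smul, h1, smul_smul, ← sub_eq_zero, ← sub_smul] at h2
  rcases smul_eq_zero.1 h2 with h3 | h3
  · have : hP.eigenvalues i * (hP.eigenvalues i - 1) = 0 := by linarith
    rcases mul_eq_zero.1 this with h4 | h4
    · exact Or.inl h4
    · exact Or.inr (by linarith)
  · exact absurd h3 hv
lemma quad_law {n m : ℕ} {P : Matrix (Fin n) (Fin n) ℝ} (hP : P.IsHermitian) (h : P * P = P)
    (ht : P.trace = m) (hm : 0 < m) :
    (Measure.pi fun _ : Fin n => gaussianReal 0 1).map (fun c => c ⬝ᵥ (P *ᵥ c)) =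
      gammaMeasure ((m : ℝ)/2) (1/2) := by
  classical
  have hmeas : Measurable (fun c : Fin n → ℝ => c ⬝ᵥ (P *ᵥ c)) := by
    simp only [dotProduct, mulVec]; fun_prop
  have h1 : (Measure.pi fun _ : Fin n => gaussianReal 0 1).map (fun c => c ⬝ᵥ (P *ᵥ c)) =
      (Measure.pi fun _ : Fin n => gaussianReal 0 1).map (fun x => ∑ i, hP.eigenvalues i * x i ^ 2) := by
    have e1 : (stdGaussian (EuclideanSpace ℝ (Fin n))).map (fun z => z.ofLp ⬝ᵥ (P *ᵥ z.ofLp)) =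
        (Measure.pi fun _ : Fin n => gaussianReal 0 1).map (fun c => c ⬝ᵥ (P *ᵥ c)) := by
      rw [← map_pi_eq_stdGaussian, Measure.map_map (by fun_prop) (by fun_prop)]
      rfl
    rw [← e1, stdGaussian_eq_map_pi_orthonormalBasis hP.eigenvectorBasis,
      Measure.map_map (by fun_prop) (by fun_prop)]
    congr 1
    ext x
    exact quad_eigen hP x
  rw [h1]
  let p : Fin n → Prop := fun i => hP.eigenvalues i = 1
  have hs : ∀ x : Fin n → ℝ, ∑ i, hP.eigenvalues i * x i ^ 2 = ∑ i : {i // p i}, x i ^ 2 := by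
    intro x
    rw [← Finset.sum_subtype (s := Finset.univ.filter p) (f := fun i => x i ^ 2) (by simp),
      Finset.sum_filter]
    refine Finset.sum_congr rfl fun i _ => ?_
    rcases idem_eigen hP h i with h0 | h0 <;> simp [p, h0]
  have hcard : Fintype.card {i // p i} = m := by
    have : (Fintype.card {i // p i} : ℝ) = m := by
      rw [← ht, hP.trace_eq_sum_eigenvalues]
      have := hs 1
      simpa using this.symm
    exact_mod_cast this
  have : Nonempty {i // p i} := Fintype.card_pos_iff.1 (by omega)
  have h2 := (measurePreserving_fst.comp
    (measurePreserving_piEquivPiSubtypeProd (fun _ : Fin n => gaussianReal 0 1) p)).map_eq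
  rw [← hcard, ← sumsq_law, ← h2, Measure.map_map (by fun_prop) (by fun_prop)]
  congr 1
  ext x
  exact hs x

lemma measurable_det_gram {d n : ℕ} : Measurable (fun C : Fin d → Fin n → ℝ => (gramM C).det) := by
  refine Continuous.measurable ?_
  unfold gramM
  refine Continuous.matrix_det ?_
  have : Continuous (fun C : Fin d → Fin n → ℝ => (Matrix.of C)) := continuous_id
  exact this.matrix_mul this.matrix_transpose

/-- standard Gaussian on `ℝ^n` -/
noncomputable abbrev gam (n : ℕ) : Measure (Fin n → ℝ) := Measure.pi fun _ => gaussianReal 0 1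

/-- `d` iid columns -/
noncomputable abbrev Gam (n d : ℕ) : Measure (Fin d → Fin n → ℝ) := Measure.pi fun _ => gam n

/-- ratio of Gram determinants -/
noncomputable def ratio {n d : ℕ} (i : Fin (d + 1)) (Z : Fin (d + 1) → Fin n → ℝ) : ℝ :=
  (gramM Z).det / (gramM (i.removeNth Z)).det

lemma measurable_removeNth {n d : ℕ} (i : Fin (d + 1)) :
    Measurable (fun Z : Fin (d + 1) → Fin n → ℝ => (i.removeNth Z : Fin d → Fin n → ℝ)) :=
  measurable_pi_lambda _ fun j => measurable_pi_apply (i.succAbove j)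

lemma measurable_ratio {n d : ℕ} (i : Fin (d + 1)) : Measurable (ratio (n := n) i) :=
  measurable_det_gram.div (measurable_det_gram.comp (measurable_removeNth i))

lemma ratio_law {n d : ℕ} (hdn : d < n) (i : Fin (d + 1))
    (hae : ∀ᵐ C ∂(Gam n d), (gramM C).det ≠ 0) :
    (Gam n (d + 1)).map (ratio i) = gammaMeasure (((n - d : ℕ) : ℝ)/2) (1/2) := by
  have hmp := (measurePreserving_piFinSuccAbove (fun _ : Fin (d + 1) => gam n) i).symm
  have hG : Gam n (d + 1) = Measure.map _ _ := hmp.map_eq.symm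
  rw [hG, Measure.map_map (measurable_ratio i) (MeasurableEquiv.measurable _)]
  have hm : Measurable ((ratio (n := n) i) ∘ (MeasurableEquiv.piFinSuccAbove (fun _ => Fin n → ℝ) i).symm) :=
    (measurable_ratio i).comp (MeasurableEquiv.measurable _)
  ext s hs
  rw [Measure.map_apply hm hs, Measure.prod_apply_symm (hm hs)]
  have : ∀ᵐ C ∂(Gam n d), gam n ((fun c => (c, C)) ⁻¹' (((ratio (n := n) i) ∘ (MeasurableEquiv.piFinSuccAbove (fun _ => Fin n → ℝ) i).symm) ⁻¹' s)) = gammaMeasure (((n - d : ℕ) : ℝ)/2) (1/2) s := by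
    filter_upwards [hae] with C hC
    rw [← quad_law (projM_herm C) (projM_idem C hC) (m := n - d)
      (by rw [projM_trace C hC, Nat.cast_sub hdn.le]) (by omega), Measure.map_apply _ hs]
    · congr 1
      ext c
      have : ratio i (i.insertNth c C : Fin (d + 1) → Fin n → ℝ) = c ⬝ᵥ (projM C *ᵥ c) := by
        rw [ratio, det_gram_insert C c i hC, Fin.removeNth_insertNth, mul_div_cancel_left₀ _ hC]
      simp only [Set.mem_preimage, Function.comp]
      rw [← this]
      rfl
    · simp only [dotProduct, mulVec]; fun_prop
  rw [lintegral_congr_ae this]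
  simp

lemma ae_det {n d : ℕ} (hdn : d ≤ n) : ∀ᵐ C ∂(Gam n d), (gramM C).det ≠ 0 := by
  induction d with
  | zero => exact Filter.Eventually.of_forall fun C => by simp
  | succ d ih =>
    have hl := ratio_law (by omega) 0 (ih (by omega))
    have h := gammaMeasure_ne_zero (((n - d : ℕ) : ℝ)/2)
    rw [← hl] at h
    have h2 := ae_of_ae_map (measurable_ratio 0).aemeasurable h
    filter_upwards [h2] with Z hZ h0
    exact hZ (by rw [ratio, h0, zero_div])

lemma removeNth_mp {n d : ℕ} (i : Fin (d + 1)) :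
    MeasurePreserving (fun Z : Fin (d + 1) → Fin n → ℝ => (i.removeNth Z : Fin d → Fin n → ℝ))
      (Gam n (d + 1)) (Gam n d) :=
  measurePreserving_snd.comp (measurePreserving_piFinSuccAbove (fun _ : Fin (d + 1) => gam n) i)

lemma log_det_main {n d : ℕ} (hdn : d ≤ n) :
    Integrable (fun C => Real.log (gramM C).det) (Gam n d) ∧
    ∫ C, Real.log (gramM C).det ∂(Gam n d) =
      ∑ j ∈ Finset.range d, (digamma (((n : ℝ) - j) / 2) + Real.log 2) := by
  induction d with
  | zero => simp
  | succ d ih =>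
    obtain ⟨ih1, ih2⟩ := ih (by omega)
    have hl := ratio_law (show d < n by omega) 0 (ae_det (by omega))
    have ha : (0:ℝ) < ((n - d : ℕ) : ℝ)/2 := by
      have : 0 < n - d := by omega
      positivity
    have hae : (fun C => Real.log (gramM C).det) =ᵐ[Gam n (d + 1)]
        fun Z => Real.log (gramM ((0 : Fin (d + 1)).removeNth Z)).det + Real.log (ratio 0 Z) := by
      filter_upwards [ae_det hdn, (removeNth_mp (n := n) (0 : Fin (d + 1))).quasiMeasurePreserving.ae
        (ae_det (show d ≤ n by omega))] with Z h1 h2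
      rw [ratio, Real.log_div h1 h2]; ring
    have hlm := (Real.measurable_log.aestronglyMeasurable (μ := (Gam n (d + 1)).map (ratio 0)))
    have i1 : Integrable (fun Z : Fin (d + 1) → Fin n → ℝ => Real.log (ratio 0 Z)) (Gam n (d + 1)) := by
      have := integrable_log_gamma ha
      rw [← hl, integrable_map_measure hlm (measurable_ratio 0).aemeasurable] at this
      exact this
    have i2 : Integrable (fun Z : Fin (d + 1) → Fin n → ℝ =>
        Real.log (gramM ((0 : Fin (d + 1)).removeNth Z)).det) (Gam n (d + 1)) :=
      (removeNth_mp (n := n) (0 : Fin (d + 1))).integrable_comp_of_integrable ih1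
    refine ⟨(i2.add i1).congr hae.symm, ?_⟩
    rw [integral_congr_ae hae, integral_add i2 i1, Finset.sum_range_succ, ← ih2]
    congr 1
    · rw [← (removeNth_mp (n := n) (0 : Fin (d + 1))).map_eq, integral_map
        (measurable_removeNth 0).aemeasurable]
      exact (Real.measurable_log.comp measurable_det_gram).aestronglyMeasurable
    · rw [← integral_map (measurable_ratio 0).aemeasurable hlm, hl, integral_log_gamma ha,
        Nat.cast_sub (by omega)]

lemma inv_diag {n d : ℕ} (Z : Fin (d + 1) → Fin n → ℝ) (i : Fin (d + 1)) :
    (gramM Z)⁻¹ i i = (ratio i Z)⁻¹ := by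
  rw [inv_def, Matrix.smul_apply, adjugate_fin_succ_eq_det_submatrix, ratio, Ring.inverse_eq_inv',
    ← two_mul, pow_mul]
  have : (gramM Z).submatrix i.succAbove i.succAbove = gramM (i.removeNth Z) := by
    ext a b; rfl
  rw [this]
  simp [div_eq_mul_inv, mul_comm]

lemma trace_main {n d : ℕ} (hdn : d + 1 < n) :
    Integrable (fun C => (gramM C)⁻¹.trace) (Gam n d) ∧
    ∫ C, (gramM C)⁻¹.trace ∂(Gam n d) = d / ((n : ℝ) - d - 1) := by
  cases d with
  | zero => simp [Matrix.trace]
  | succ d =>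
    have ha : (1:ℝ) < ((n - d : ℕ) : ℝ)/2 := by
      have : 2 < n - d := by omega
      have : (2:ℝ) < ((n - d : ℕ) : ℝ) := by exact_mod_cast this
      linarith
    have key : ∀ i : Fin (d + 1), Integrable (fun Z => (ratio (n := n) i Z)⁻¹) (Gam n (d + 1)) ∧
        ∫ Z, (ratio (n := n) i Z)⁻¹ ∂(Gam n (d + 1)) = 1 / ((n : ℝ) - d - 2) := by
      intro i
      have hl := ratio_law (show d < n by omega) i (ae_det (by omega))
      have hlm : AEStronglyMeasurable (fun x : ℝ => x⁻¹) ((Gam n (d + 1)).map (ratio i)) :=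
        measurable_inv.aestronglyMeasurable
      constructor
      · have := integrable_inv_gamma ha
        rw [← hl, integrable_map_measure hlm (measurable_ratio i).aemeasurable] at this
        exact this
      · rw [← integral_map (measurable_ratio i).aemeasurable hlm, hl, integral_inv_gamma ha,
          Nat.cast_sub (by omega)]
        congr 1; ring
    simp only [Matrix.trace, Matrix.diag, inv_diag]
    refine ⟨integrable_finsetSum _ fun i _ => (key i).1, ?_⟩
    rw [integral_finsetSum _ fun i _ => (key i).1]
    simp only [(key _).2]
    simp
    rw [← div_eq_mul_inv]
    congr 1
    ring

lemma transpose_mp (n d : ℕ) :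
    MeasurePreserving (fun (Y : Fin n → Fin d → ℝ) (j : Fin d) (i : Fin n) => Y i j)
      (stdGaussianSample n d) (Gam n d) := by
  have hm : Measurable (fun (Y : Fin n → Fin d → ℝ) (j : Fin d) (i : Fin n) => Y i j) := by
    fun_prop
  refine ⟨hm, ?_⟩
  have h1 : ∀ a b : ℕ, (Measure.pi fun _ : Fin a => Measure.pi fun _ : Fin b => gaussianReal 0 1) =
      (Measure.pi fun _ : Fin a × Fin b => gaussianReal 0 1).map (MeasurableEquiv.curry (Fin a) (Fin b) ℝ) := by
    intro a b
    have := Measure.infinitePi_map_curry (ι := Fin a) (κ := Fin b) (X := ℝ) (fun _ _ => gaussianReal 0 1)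
    simpa [Measure.infinitePi_eq_pi] using this.symm
  have h2 := (measurePreserving_piCongrLeft (fun _ : Fin d × Fin n => gaussianReal 0 1)
    (Equiv.prodComm (Fin n) (Fin d))).map_eq
  rw [stdGaussianSample, Gam, gam, h1, h1, ← h2, Measure.map_map hm (MeasurableEquiv.measurable _),
    Measure.map_map (MeasurableEquiv.measurable _) (MeasurableEquiv.measurable _)]
  congr 1

lemma emp_eq (n d : ℕ) (Y : Fin n → Fin d → ℝ) :
    empSecondMoment n d Y = ((n : ℝ)⁻¹) • gramM (fun j i => Y i j) := by
  rw [empSecondMoment]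
  congr 1
  ext a b
  simp [gramM, Matrix.mul_apply, Matrix.sum_apply, vecMulVec_apply]

theorem forward_KL_known_mean_closed_form (d n : ℕ) (hd : 1 ≤ d) (hn : d + 1 < n) :
    ∫ Y, (1 / 2) * (Real.log (empSecondMoment n d Y).det
        + ((empSecondMoment n d Y)⁻¹).trace - d) ∂(stdGaussianSample n d)
      = (1 / 2) * (fFun d n - d) := by
  have hn0 : (n : ℝ) ≠ 0 := by have : n ≠ 0 := by omega
                               exact_mod_cast this
  simp only [emp_eq]
  have hmT : Measurable (fun C : Fin d → Fin n → ℝ => ((gramM C)⁻¹).trace) := by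
    cases d with
    | zero => simp [Matrix.trace]
    | succ d =>
      simp only [Matrix.trace, Matrix.diag, inv_diag]
      exact Finset.measurable_sum _ fun i _ => (measurable_ratio i).inv
  obtain ⟨l1, l2⟩ := log_det_main (show d ≤ n by omega)
  obtain ⟨t1, t2⟩ := trace_main hn
  have hae : ∀ᵐ Y ∂(stdGaussianSample n d),
      (1 / 2) * (Real.log (((n : ℝ)⁻¹) • gramM (fun j i => Y i j)).det
        + ((((n : ℝ)⁻¹) • gramM (fun j i => Y i j))⁻¹).trace - d) =
      (fun C => (1 / 2) * (Real.log (gramM C).det + n * ((gramM C)⁻¹).trace - (d * Real.log n + d)))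
        (fun j i => Y i j) := by
    filter_upwards [(transpose_mp n d).quasiMeasurePreserving.ae (ae_det (show d ≤ n by omega))] with Y hY
    have hinv : (((n : ℝ)⁻¹) • gramM (fun j i => Y i j))⁻¹ = (n : ℝ) • (gramM (fun j i => Y i j))⁻¹ := by
      refine inv_eq_right_inv ?_
      rw [Matrix.smul_mul, Matrix.mul_smul, mul_nonsing_inv _ (isUnit_iff_ne_zero.2 hY), smul_smul,
        inv_mul_cancel₀ hn0, one_smul]
    rw [hinv, det_smul, Real.log_mul (by positivity) hY, trace_smul, Fintype.card_fin, Real.log_pow,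
      Real.log_inv, smul_eq_mul]
    ring
  rw [integral_congr_ae hae, ← integral_map (transpose_mp n d).measurable.aemeasurable
    (f := fun C => (1 / 2) * (Real.log (gramM C).det + n * ((gramM C)⁻¹).trace - (d * Real.log n + d))),
    (transpose_mp n d).map_eq, integral_const_mul,
    integral_sub (f := fun C => Real.log (gramM C).det + n * ((gramM C)⁻¹).trace)
      (l1.add (t1.const_mul _)) (integrable_const _), integral_add l1 (t1.const_mul _),
    integral_const_mul, l2, t2, integral_const]
  · have hsum : ∀ d : ℕ, ∑ j ∈ Finset.Icc 1 d, digamma (((n : ℝ) - j + 1) / 2) =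
        ∑ j ∈ Finset.range d, digamma (((n : ℝ) - j) / 2) := by
      intro d
      induction d with
      | zero => simp
      | succ d ih =>
        rw [Finset.sum_Icc_succ_top (by omega), Finset.sum_range_succ, ih]
        push_cast
        ring_nf
    rw [fFun, hsum, Finset.sum_add_distrib, Real.log_div hn0 (by norm_num)]
    simp only [Finset.sum_const, Finset.card_range, nsmul_eq_mul, smul_eq_mul, probReal_univ]
    ring
  · exact (((Real.measurable_log.comp measurable_det_gram).add (hmT.const_mul _)).sub_const _ |>.const_mul _).aestronglyMeasurable
end

section
/- For every integer d ≥ 1, the function f_d(x) := (∑_{j=1}^d ψ((x−j+1)/2)) − d·log(x/2) + x·d/(x−d−1) is strictly decreasing on the interval (d+1, ∞); that is, for all x, y with d+1 < x < y one has f_d(y) < f_d(x). -/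
open Filter Topology Set in
theorem aux_diff {t : ℝ} (ht : 0 < t) :
    DifferentiableAt ℝ (fun t => Real.log (Real.Gamma t)) t := by
  refine DifferentiableAt.log (Real.differentiableAt_Gamma fun m => ?_) (Real.Gamma_pos_of_pos ht).ne'
  have : (0 : ℝ) ≤ m := Nat.cast_nonneg m
  linarith

theorem aux_step {t : ℝ} (ht : 0 < t) :
    Real.log (Real.Gamma (t + 1)) = Real.log t + Real.log (Real.Gamma t) := by
  rw [Real.Gamma_add_one ht.ne', Real.log_mul ht.ne' (Real.Gamma_pos_of_pos ht).ne']

theorem digamma_step {t : ℝ} (ht : 0 < t) : digamma (t + 1) = digamma t + 1 / t := by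
  have h1 : HasDerivAt (fun s => Real.log (Real.Gamma (s + 1))) (digamma (t + 1)) t := by
    have := (aux_diff (show 0 < t + 1 by linarith)).hasDerivAt
    exact this.comp_add_const t 1
  have h2 : HasDerivAt (fun s => Real.log s + Real.log (Real.Gamma s)) (t⁻¹ + digamma t) t :=
    (Real.hasDerivAt_log ht.ne').add (aux_diff ht).hasDerivAt
  have h3 : HasDerivAt (fun s => Real.log (Real.Gamma (s + 1))) (t⁻¹ + digamma t) t := by
    refine h2.congr_of_eventuallyEq ?_
    filter_upwards [lt_mem_nhds ht] with s hs using aux_step hs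
  rw [h1.unique h3, one_div, add_comm]

theorem digamma_le {t : ℝ} (ht : 0 < t) : digamma t ≤ Real.log t := by
  have h := Real.convexOn_log_Gamma.deriv_le_slope (x := t) (y := t + 1) ht
    (show (0 : ℝ) < t + 1 by linarith) (by linarith) (aux_diff ht)
  have h2 := aux_step ht
  simp only [slope_def_field, Function.comp] at h
  rw [h2] at h
  have : deriv (Real.log ∘ Real.Gamma) t = digamma t := rfl
  rw [this] at h
  simpa using h

theorem le_digamma {t : ℝ} (ht : 0 < t) : Real.log t ≤ digamma (t + 1) := by
  have h := Real.convexOn_log_Gamma.slope_le_deriv (x := t) (y := t + 1) ht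
    (show (0 : ℝ) < t + 1 by linarith) (by linarith) (aux_diff (by linarith))
  have h2 := aux_step ht
  simp only [slope_def_field, Function.comp] at h
  rw [h2] at h
  have : deriv (Real.log ∘ Real.Gamma) (t + 1) = digamma (t + 1) := rfl
  rw [this] at h
  simpa using h

/-- `ψ(t) - log (t - 1/2)`. -/
noncomputable def gAux (t : ℝ) : ℝ := digamma t - Real.log (t - 1 / 2)

theorem gAux_step_anti {a b : ℝ} (ha : 1 / 2 < a) (hab : a ≤ b) :
    gAux b - gAux (b + 1) ≤ gAux a - gAux (a + 1) := by
  have key : AntitoneOn (fun t : ℝ => Real.log (t + 1 / 2) - Real.log (t - 1 / 2) - t⁻¹)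
      (Set.Ioi (1 / 2)) := by
    have hd : ∀ t ∈ Set.Ioi (1 / 2 : ℝ),
        HasDerivAt (fun t : ℝ => Real.log (t + 1 / 2) - Real.log (t - 1 / 2) - t⁻¹)
          (1 / (t + 1 / 2) - 1 / (t - 1 / 2) - -(t ^ 2)⁻¹) t := by
      intro t ht
      have ht' : 1 / 2 < t := ht
      refine ((((hasDerivAt_id t).add_const _).log ?_).sub
        (((hasDerivAt_id t).sub_const _).log ?_)).sub (hasDerivAt_inv ?_)
      · (try simp only [id]); linarith
      · (try simp only [id]); linarith
      · linarith
    refine antitoneOn_of_deriv_nonpos (convex_Ioi _)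
      (fun t ht => (hd t ht).continuousAt.continuousWithinAt)
      (fun t ht => ((hd t (interior_subset ht)).differentiableAt).differentiableWithinAt) ?_
    intro t ht
    have ht1 := interior_subset ht
    rw [(hd t ht1).deriv]
    have ht' : 1 / 2 < t := ht1
    have h1 : 0 < t - 1 / 2 := by linarith
    have h2 : 0 < t + 1 / 2 := by linarith
    have h3 : 0 < t := by linarith
    have : 1 / (t + 1 / 2) - 1 / (t - 1 / 2) - -(t ^ 2)⁻¹
        = - ((1 / 4) / ((t + 1 / 2) * (t - 1 / 2) * t ^ 2)) := by
      have h4 : t * 2 - 1 ≠ 0 := by linarith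
      have h5 : 2 * t - 1 ≠ 0 := by linarith
      field_simp
      ring
    rw [this]
    have : 0 < (1 / 4) / ((t + 1 / 2) * (t - 1 / 2) * t ^ 2) := by positivity
    linarith
  have h := key (show a ∈ Set.Ioi (1 / 2 : ℝ) from ha)
    (show b ∈ Set.Ioi (1 / 2 : ℝ) from lt_of_lt_of_le ha hab) hab
  simp only at h
  have e : ∀ t : ℝ, 1 / 2 < t → gAux t - gAux (t + 1)
      = Real.log (t + 1 / 2) - Real.log (t - 1 / 2) - t⁻¹ := by
    intro t ht
    unfold gAux
    rw [digamma_step (by linarith), show t + 1 - 1 / 2 = t + 1 / 2 by ring]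
    ring
  rw [e a ha, e b (by linarith)]
  exact h

theorem gAux_nat {a b : ℝ} (ha : 1 / 2 < a) (hab : a ≤ b) (n : ℕ) :
    gAux b - gAux a ≤ gAux (b + n) - gAux (a + n) := by
  induction n with
  | zero => simp
  | succ n ih =>
    have hn : (0 : ℝ) ≤ n := Nat.cast_nonneg n
    have := gAux_step_anti (a := a + n) (b := b + n) (by linarith) (by linarith)
    push_cast
    rw [← add_assoc, ← add_assoc]
    linarith

theorem gAux_bound {t : ℝ} (ht : 1 < t) : |gAux t| ≤ 1 / (t - 1) := by
  have h1 := digamma_le (show 0 < t by linarith)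
  have h2 := le_digamma (show 0 < t - 1 by linarith)
  rw [sub_add_cancel] at h2
  have hp : 0 < t - 1 := by linarith
  have h3 : Real.log (t - 1) ≤ Real.log (t - 1 / 2) := Real.log_le_log hp (by linarith)
  have h4 : Real.log (t - 1 / 2) ≤ Real.log t := Real.log_le_log (by linarith) (by linarith)
  have h5 : Real.log t - Real.log (t - 1) ≤ 1 / (t - 1) := by
    rw [← Real.log_div (by linarith) hp.ne']
    have := Real.log_le_sub_one_of_pos (show 0 < t / (t - 1) by positivity)
    have e : t / (t - 1) - 1 = 1 / (t - 1) := by field_simp; ring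
    linarith
  unfold gAux
  rw [abs_le]
  constructor <;> linarith

open Filter Topology in
theorem gAux_tendsto (a : ℝ) : Tendsto (fun n : ℕ => gAux (a + n)) atTop (𝓝 0) := by
  have hT : Tendsto (fun n : ℕ => a + (n : ℝ)) atTop atTop :=
    tendsto_atTop_add_const_left _ _ tendsto_natCast_atTop_atTop
  have hT' : Tendsto (fun n : ℕ => 1 / (a + (n : ℝ) - 1)) atTop (𝓝 0) := by
    simp only [one_div]
    exact tendsto_inv_atTop_zero.comp (tendsto_atTop_add_const_right _ (-1) hT)
  refine squeeze_zero_norm' ?_ hT'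
  filter_upwards [hT.eventually_gt_atTop 1] with n hn using gAux_bound hn

open Filter Topology in
theorem gAux_anti {a b : ℝ} (ha : 1 / 2 < a) (hab : a ≤ b) : gAux b ≤ gAux a := by
  have h := ge_of_tendsto' ((gAux_tendsto b).sub (gAux_tendsto a)) (gAux_nat ha hab)
  linarith

theorem elem_anti {d j x y : ℝ} (hj : 1 ≤ j) (hjd : j ≤ d) (hx : d + 1 < x) (hxy : x < y) :
    Real.log (y - j) - Real.log y + y / (y - d - 1)
      < Real.log (x - j) - Real.log x + x / (x - d - 1) := by
  have key : StrictAntiOn (fun t : ℝ => Real.log (t - j) - Real.log t + t / (t - d - 1))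
      (Set.Ioi (d + 1)) := by
    have hd : ∀ t ∈ Set.Ioi (d + 1),
        HasDerivAt (fun t : ℝ => Real.log (t - j) - Real.log t + t / (t - d - 1))
          (1 / (t - j) - t⁻¹ + (1 * (t - d - 1) - t * 1) / (t - d - 1) ^ 2) t := by
      intro t ht
      have ht' : d + 1 < t := ht
      refine ((((hasDerivAt_id t).sub_const _).log ?_).sub (Real.hasDerivAt_log ?_)).add
        ((hasDerivAt_id t).div (((hasDerivAt_id t).sub_const _).sub_const _) ?_)
      · (try simp only [id]); linarith
      · linarith
      · (try simp only [id]); linarith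
    refine strictAntiOn_of_deriv_neg (convex_Ioi _)
      (fun t ht => (hd t ht).continuousAt.continuousWithinAt) ?_
    intro t ht
    have ht1 := interior_subset ht
    rw [(hd t ht1).deriv]
    have ht' : d + 1 < t := ht1
    have h1 : 0 < t - j := by linarith
    have h2 : 0 < t := by linarith
    have h3 : 0 < t - d - 1 := by linarith
    have e1 : 1 / (t - j) - t⁻¹ = j / (t * (t - j)) := by field_simp; ring
    have e2 : (1 * (t - d - 1) - t * 1) / (t - d - 1) ^ 2 = - ((d + 1) / (t - d - 1) ^ 2) := by
      rw [← neg_div]; congr 1; ring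
    have h4 : j / (t * (t - j)) < (d + 1) / (t - d - 1) ^ 2 := by
      apply div_lt_div₀ (by linarith) _ (by linarith) (by positivity)
      nlinarith
    rw [e1, e2]
    linarith
  exact key hx (show d + 1 < y by linarith) hxy

theorem fFun_eq (d : ℕ) (x : ℝ) : fFun d x = ∑ j ∈ Finset.Icc 1 d,
    (digamma ((x - j + 1) / 2) - Real.log (x / 2) + x / (x - d - 1)) := by
  unfold fFun
  rw [Finset.sum_add_distrib, Finset.sum_sub_distrib]
  simp only [Finset.sum_const, Nat.card_Icc, nsmul_eq_mul, Nat.add_sub_cancel]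
  ring

theorem fFun_strictAnti (d : ℕ) (hd : 1 ≤ d) :
    ∀ x y : ℝ, (d : ℝ) + 1 < x → x < y → fFun d y < fFun d x := by
  intro x y hx hxy
  rw [fFun_eq, fFun_eq]
  refine Finset.sum_lt_sum_of_nonempty ⟨1, by simp [hd]⟩ ?_
  intro j hj
  rw [Finset.mem_Icc] at hj
  have hj1 : (1 : ℝ) ≤ j := by exact_mod_cast hj.1
  have hj2 : (j : ℝ) ≤ d := by exact_mod_cast hj.2
  have h1 := elem_anti hj1 hj2 hx hxy
  have h2 := gAux_anti (a := (x - j + 1) / 2) (b := (y - j + 1) / 2) (by linarith) (by linarith)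
  unfold gAux at h2
  rw [show (x - j + 1) / 2 - 1 / 2 = (x - j) / 2 by ring,
    show (y - j + 1) / 2 - 1 / 2 = (y - j) / 2 by ring,
    Real.log_div (by linarith) (by norm_num), Real.log_div (by linarith) (by norm_num)] at h2
  rw [Real.log_div (x := y) (by linarith) (by norm_num),
    Real.log_div (x := x) (by linarith) (by norm_num)]
  linarith
end

section
/- Let α > 0, θ* > 0, and let n ≥ 1 be an integer with nα > 1. Let μ be the Gamma distribution with shape nα and scale θ*/(nα) (the law of the MLE θ̂_n = (1/(nα))∑_{i=1}^n X_i for X_i i.i.d. Gamma(α, θ*)). Then the expected forward KL risk equals ∫ α·( log(t/θ*) + θ*/t − 1 ) dμ(t) = α·( ψ(nα) − log(nα) + 1/(nα − 1) ). (The integrand α(log(t/θ*) + θ*/t − 1) equals the forward KL divergence D_KL(Gamma(α,θ*) ‖ Gamma(α,t)).) -/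
open MeasureTheory ProbabilityTheory

lemma gammaMeasure_ae_pos (a r : ℝ) : ∀ᵐ t ∂(gammaMeasure a r), 0 < t := by
  have hm : Measurable (gammaPDF a r) := (measurable_gammaPDFReal a r).ennreal_ofReal
  rw [gammaMeasure, ae_withDensity_iff hm]
  have h0 : ∀ᵐ t : ℝ, t ≠ 0 := by simp [ae_iff, measure_singleton]
  filter_upwards [h0] with t ht h
  by_contra hc
  exact h (gammaPDF_of_neg (lt_of_le_of_ne (not_lt.mp hc) ht))

lemma gamma_moment {a r s : ℝ} (ha : 0 < a) (hr : 0 < r) (hs : 0 < a + s) :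
    ∫ t, Real.exp (s * Real.log t) ∂(gammaMeasure a r)
      = (1 / r) ^ s * Real.Gamma (a + s) / Real.Gamma a := by
  have hm : Measurable (gammaPDF a r) := (measurable_gammaPDFReal a r).ennreal_ofReal
  rw [gammaMeasure, integral_withDensity_eq_integral_toReal_smul hm
    (Filter.Eventually.of_forall fun x => by simp [gammaPDF])]
  have h1 : ∫ t, (gammaPDF a r t).toReal • Real.exp (s * Real.log t)
      = ∫ t in Set.Ici (0:ℝ), (gammaPDF a r t).toReal • Real.exp (s * Real.log t) := by
    symm
    apply setIntegral_eq_integral_of_forall_compl_eq_zero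
    intro x hx
    rw [gammaPDF_of_neg (by simpa using hx)]
    simp
  rw [h1, integral_Ici_eq_integral_Ioi]
  have h2 : ∫ t in Set.Ioi (0:ℝ), (gammaPDF a r t).toReal • Real.exp (s * Real.log t)
      = ∫ t in Set.Ioi (0:ℝ), (r ^ a / Real.Gamma a) *
          (t ^ ((a + s) - 1) * Real.exp (-(r * t))) := by
    apply setIntegral_congr_fun measurableSet_Ioi
    intro t ht
    have ht : 0 < t := ht
    have hG := Real.Gamma_pos_of_pos ha
    simp only [smul_eq_mul]
    rw [gammaPDF_of_nonneg ht.le, ENNReal.toReal_ofReal (by positivity), mul_comm s,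
      ← Real.rpow_def_of_pos ht, show a + s - 1 = (a - 1) + s by ring, Real.rpow_add ht]
    ring
  rw [h2, integral_const_mul, Real.integral_rpow_mul_exp_neg_mul_Ioi hs hr,
    Real.rpow_add (by positivity), one_div, Real.inv_rpow hr.le]
  have := (Real.rpow_pos_of_pos hr a).ne'
  field_simp

lemma gamma_moment_integrable {a r s : ℝ} (ha : 0 < a) (hr : 0 < r) (hs : 0 < a + s) :
    Integrable (fun t => Real.exp (s * Real.log t)) (gammaMeasure a r) := by
  apply Integrable.of_integral_ne_zero
  rw [gamma_moment ha hr hs]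
  have := Real.Gamma_pos_of_pos ha
  have := Real.Gamma_pos_of_pos hs
  positivity

lemma zero_mem_interior {a r : ℝ} (ha : 0 < a) (hr : 0 < r) :
    (0:ℝ) ∈ interior (integrableExpSet Real.log (gammaMeasure a r)) := by
  rw [mem_interior]
  exact ⟨Set.Ioi (-a), fun s hs => gamma_moment_integrable ha hr
    (by have : -a < s := hs
        linarith), isOpen_Ioi, by simpa using ha⟩

lemma gamma_integrable_log {a r : ℝ} (ha : 0 < a) (hr : 0 < r) :
    Integrable Real.log (gammaMeasure a r) := by
  simpa using integrable_pow_of_mem_interior_integrableExpSet (zero_mem_interior ha hr) 1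

lemma gamma_integral_log {a r : ℝ} (ha : 0 < a) (hr : 0 < r) :
    ∫ t, Real.log t ∂(gammaMeasure a r) = digamma a - Real.log r := by
  have := isProbabilityMeasure_gammaMeasure ha hr
  have hG := Real.Gamma_pos_of_pos ha
  have h1 := hasDerivAt_mgf (zero_mem_interior ha hr)
  simp only [zero_mul, Real.exp_zero, mul_one] at h1
  have hd : HasDerivAt Real.Gamma (deriv Real.Gamma a) a :=
    (Real.differentiableAt_Gamma (fun m => by
      have : (0:ℝ) ≤ m := Nat.cast_nonneg m
      linarith)).hasDerivAt
  have hdig : digamma a = deriv Real.Gamma a / Real.Gamma a := (hd.log hG.ne').deriv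
  have hd' : HasDerivAt (fun s => Real.Gamma (a + s)) (deriv Real.Gamma a) 0 := by
    have : HasDerivAt Real.Gamma (deriv Real.Gamma a) (a + 0) := by simpa using hd
    simpa using this.comp_const_add a 0
  have hp : HasDerivAt (fun s : ℝ => (1 / r) ^ s) (- Real.log r) 0 := by
    have := (hasDerivAt_id (0:ℝ)).const_rpow (a := 1 / r) (by positivity)
    simpa using this
  have h2 := (hp.mul hd').div_const (Real.Gamma a)
  have h3 : mgf Real.log (gammaMeasure a r) =ᶠ[nhds 0]
      fun s => (1 / r) ^ s * Real.Gamma (a + s) / Real.Gamma a := by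
    filter_upwards [Ioi_mem_nhds (show -a < 0 by linarith)] with s hs
    have hs : -a < s := hs
    exact gamma_moment ha hr (by linarith)
  have h4 := h1.unique (h2.congr_of_eventuallyEq h3)
  rw [h4, hdig]
  simp
  field_simp
  ring

theorem gamma_forward_KL_closed_form (α θ : ℝ) (hα : 0 < α) (hθ : 0 < θ)
    (n : ℕ) (hn : 1 ≤ n) (hnα : 1 < n * α) :
    ∫ t, α * (Real.log (t / θ) + θ / t - 1)
        ∂(gammaMeasure (n * α) (n * α / θ))
      = α * (digamma (n * α) - Real.log (n * α) + 1 / (n * α - 1)) := by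
  generalize (n * α : ℝ) = a at *
  have ha : 0 < a := by linarith
  have hr : 0 < a / θ := by positivity
  have := isProbabilityMeasure_gammaMeasure ha hr
  have hs : 0 < a + (-1) := by linarith
  have hI := (gamma_moment_integrable ha hr hs).const_mul θ
  have hL := gamma_integrable_log ha hr
  have e : ∫ t, α * (Real.log (t / θ) + θ / t - 1) ∂(gammaMeasure a (a / θ))
      = ∫ t, α * ((Real.log t + θ * Real.exp (-1 * Real.log t)) - (Real.log θ + 1))
        ∂(gammaMeasure a (a / θ)) := by
    apply integral_congr_ae
    filter_upwards [gammaMeasure_ae_pos a (a / θ)] with t ht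
    rw [Real.log_div ht.ne' hθ.ne', neg_one_mul, Real.exp_neg, Real.exp_log ht]
    ring
  have hGa : Real.Gamma a = (a - 1) * Real.Gamma (a - 1) := by
    have := Real.Gamma_add_one (s := a - 1) (by linarith)
    simpa using this
  have hG := Real.Gamma_pos_of_pos hs
  rw [← sub_eq_add_neg] at hG hs
  have hS : Integrable (fun t => Real.log t + θ * Real.exp (-1 * Real.log t))
      (gammaMeasure a (a / θ)) := hL.add hI
  rw [e, integral_const_mul, integral_sub hS (integrable_const _),
    integral_add hL hI, integral_const_mul, gamma_integral_log ha hr,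
    gamma_moment ha hr (by linarith), integral_const, Real.log_div ha.ne' hθ.ne',
    ← sub_eq_add_neg, hGa, Real.rpow_neg_one]
  have hs' : a - 1 ≠ 0 := hs.ne'
  have k : θ * ((1 / (a / θ))⁻¹ * Real.Gamma (a - 1) / ((a - 1) * Real.Gamma (a - 1)))
      = 1 + 1 / (a - 1) := by
    field_simp
    ring
  rw [k]
  simp only [probReal_univ, one_smul]
  ring
end

section
/- The function h(t) := ψ(t) − log t + 1/(t − 1) is strictly decreasing on the interval (1, ∞); that is, for all t, s with 1 < t < s one has h(s) < h(t). -/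
open Real Set Filter Topology

namespace DigammaAux

lemma hasDeriv {x : ℝ} (hx : 0 < x) : HasDerivAt (Real.log ∘ Real.Gamma) (digamma x) x := by
  have h1 : DifferentiableAt ℝ Real.Gamma x :=
    Real.differentiableAt_Gamma (fun m => by have : (0:ℝ) ≤ m := Nat.cast_nonneg m; linarith)
  exact (h1.log (Real.Gamma_pos_of_pos hx).ne').hasDerivAt

lemma logGamma_add_one {x : ℝ} (hx : 0 < x) :
    (Real.log ∘ Real.Gamma) (x + 1) = (Real.log ∘ Real.Gamma) x + Real.log x := by
  simp only [Function.comp]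
  rw [Real.Gamma_add_one hx.ne', Real.log_mul hx.ne' (Real.Gamma_pos_of_pos hx).ne', add_comm]

lemma digamma_add_one {x : ℝ} (hx : 0 < x) : digamma (x + 1) = digamma x + 1 / x := by
  have h1 : HasDerivAt (fun y => (Real.log ∘ Real.Gamma) (y + 1)) (digamma (x + 1)) x :=
    (hasDeriv (by linarith : 0 < x + 1)).comp_add_const x 1
  have h2 : HasDerivAt (fun y => (Real.log ∘ Real.Gamma) y + Real.log y) (digamma x + x⁻¹) x :=
    (hasDeriv hx).add (Real.hasDerivAt_log hx.ne')
  have h3 : (fun y => (Real.log ∘ Real.Gamma) (y + 1)) =ᶠ[𝓝 x]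
      (fun y => (Real.log ∘ Real.Gamma) y + Real.log y) := by
    filter_upwards [lt_mem_nhds hx] with y hy using logGamma_add_one hy
  rw [one_div]
  exact h1.unique (h2.congr_of_eventuallyEq h3)

lemma digamma_le {x : ℝ} (hx : 0 < x) : digamma x ≤ Real.log x := by
  have := Real.convexOn_log_Gamma.le_slope_of_hasDerivAt (x := x) (y := x + 1) hx
    (by simp; linarith) (by linarith) (hasDeriv hx)
  rw [slope_def_field, logGamma_add_one hx] at this
  simpa using this

lemma le_digamma {x : ℝ} (hx : 0 < x) : Real.log x ≤ digamma (x + 1) := by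
  have := Real.convexOn_log_Gamma.slope_le_of_hasDerivAt (x := x) (y := x + 1) hx
    (by simp; linarith) (by linarith) (hasDeriv (by linarith))
  rw [slope_def_field, logGamma_add_one hx] at this
  simpa using this

/-- the risk function -/
noncomputable def h (t : ℝ) : ℝ := digamma t - Real.log t + 1 / (t - 1)

lemma h_le {t : ℝ} (ht : 1 < t) : h t ≤ 1 / (t - 1) := by
  have := digamma_le (by linarith : 0 < t)
  unfold h; linarith

lemma h_nonneg {t : ℝ} (ht : 1 < t) : 0 ≤ h t := by
  have h1 := le_digamma (by linarith : 0 < t - 1)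
  have hp : 0 < t - 1 := by linarith
  rw [sub_add_cancel] at h1
  have h2 := Real.log_le_sub_one_of_pos (show 0 < t / (t - 1) by positivity)
  rw [Real.log_div (by linarith) hp.ne'] at h2
  have h3 : t / (t - 1) - 1 = 1 / (t - 1) := by field_simp; ring
  unfold h; linarith

/-- the difference of the risk function -/
noncomputable def d (t : ℝ) : ℝ := Real.log (t + 1) - Real.log t + 1 / (t - 1) - 2 / t

lemma h_sub {t : ℝ} (ht : 1 < t) : h t - h (t + 1) = d t := by
  unfold h d
  rw [digamma_add_one (by linarith), add_sub_cancel_right]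
  ring

lemma d_anti : StrictAntiOn d (Ioi 1) := by
  have key : ∀ t : ℝ, 1 < t → HasDerivAt d
      (1 / (t + 1) - 1 / t + (-1) / (t - 1) ^ 2 - (-2) / t ^ 2) t := by
    intro t ht
    have a1 : HasDerivAt (fun y : ℝ => Real.log (y + 1)) (1 / (t + 1)) t :=
      ((hasDerivAt_id t).add_const 1).log (by simp; linarith)
    have a2 : HasDerivAt (fun y : ℝ => Real.log y) (1 / t) t :=
      (hasDerivAt_id t).log (by simp; linarith)
    have a3 : HasDerivAt (fun y : ℝ => 1 / (y - 1)) ((-1) / (t - 1) ^ 2) t := by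
      simp only [one_div]
      exact ((hasDerivAt_id t).sub_const 1).inv (by simp; linarith)
    have a4 : HasDerivAt (fun y : ℝ => 2 / y) ((-2) / t ^ 2) t := by
      have h2 := (hasDerivAt_inv (zero_lt_one.trans ht).ne').const_mul 2
      have e : (-2) / t ^ 2 = 2 * -(t ^ 2)⁻¹ := by ring
      rw [e]
      exact h2
    exact ((a1.sub a2).add a3).sub a4
  refine strictAntiOn_of_deriv_neg (convex_Ioi 1)
    (fun t ht => (key t ht).continuousAt.continuousWithinAt) ?_
  intro t ht
  rw [interior_Ioi] at ht
  have ht' : 1 < t := ht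
  rw [(key t ht).deriv]
  have p1 : 0 < t - 1 := by linarith
  have p2 : 0 < t := by linarith
  have p3 : 0 < t + 1 := by linarith
  have e : 1 / (t + 1) - 1 / t + (-1) / (t - 1) ^ 2 - (-2) / t ^ 2
      = -((t ^ 2 + 3 * t - 2) / ((t + 1) * (t - 1) ^ 2 * t ^ 2)) := by
    field_simp
    ring
  rw [e]
  have : 0 < t ^ 2 + 3 * t - 2 := by nlinarith
  have : 0 < (t ^ 2 + 3 * t - 2) / ((t + 1) * (t - 1) ^ 2 * t ^ 2) := by positivity
  linarith

end DigammaAux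

open DigammaAux in
theorem digamma_risk_strictAnti :
    ∀ t s : ℝ, 1 < t → t < s →
      digamma s - Real.log s + 1 / (s - 1) < digamma t - Real.log t + 1 / (t - 1) := by
  intro t s ht hts
  have hs : 1 < s := ht.trans hts
  change h s < h t
  have step : ∀ n : ℕ, h (t + (n + 1 : ℕ)) - h (s + (n + 1 : ℕ)) < h (t + n) - h (s + n) := by
    intro n
    have hn : (0:ℝ) ≤ n := Nat.cast_nonneg n
    have a := h_sub (by linarith : 1 < t + n)
    have b := h_sub (by linarith : 1 < s + n)
    have c := d_anti (show t + n ∈ Ioi (1:ℝ) by simp; linarith)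
      (show s + n ∈ Ioi (1:ℝ) by simp; linarith) (by linarith)
    push_cast
    rw [← add_assoc, ← add_assoc]
    linarith
  have anti : StrictAnti (fun n : ℕ => h (t + n) - h (s + n)) := strictAnti_nat_of_succ_lt step
  have h1 : 0 ≤ h (t + (1 : ℕ)) - h (s + (1 : ℕ)) := by
    have lim : Tendsto (fun n : ℕ => -(1 / ((n : ℝ) + (s - 1)))) atTop (𝓝 0) := by
      have : Tendsto (fun n : ℕ => (n : ℝ) + (s - 1)) atTop atTop :=
        tendsto_atTop_add_const_right _ _ tendsto_natCast_atTop_atTop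
      simpa [one_div] using this.inv_tendsto_atTop.neg
    refine le_of_tendsto lim ?_
    filter_upwards [eventually_ge_atTop 1] with n hn
    have hn' : (0:ℝ) ≤ n := Nat.cast_nonneg n
    have a := anti.antitone hn
    have b := h_nonneg (by linarith : 1 < t + n)
    have c := h_le (by linarith : 1 < s + n)
    have e : s + n - 1 = (n : ℝ) + (s - 1) := by ring
    rw [e] at c
    refine le_trans ?_ a
    change -(1 / ((n : ℝ) + (s - 1))) ≤ h (t + n) - h (s + n)
    linarith
  have h0 := step 0
  simp only [Nat.cast_zero, add_zero, zero_add] at h0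
  linarith
end

section
/- For every integer d ≥ 1, the function r_d(x) := d·log(x/2) − ∑_{j=1}^d ψ((x−j+1)/2) is strictly decreasing on the interval (d−1, ∞); that is, for all x, y with d−1 < x < y one has r_d(y) < r_d(x). -/
/-- `r_d(x) = d log(x/2) - ∑_{j=1}^d ψ((x-j+1)/2)`. -/
noncomputable def rFun (d : ℕ) (x : ℝ) : ℝ :=
  d * Real.log (x / 2) - ∑ j ∈ Finset.Icc 1 d, digamma ((x - j + 1) / 2)

lemma lg_diff {x : ℝ} (hx : 0 < x) :
    DifferentiableAt ℝ (fun t => Real.log (Real.Gamma t)) x := by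
  have h1 : DifferentiableAt ℝ Real.Gamma x :=
    Real.differentiableAt_Gamma (fun m => by
      have : (0 : ℝ) ≤ m := Nat.cast_nonneg m
      linarith)
  exact h1.log (Real.Gamma_pos_of_pos hx).ne'

lemma lg_add_one {x : ℝ} (hx : 0 < x) :
    Real.log (Real.Gamma (x + 1)) = Real.log x + Real.log (Real.Gamma x) := by
  rw [Real.Gamma_add_one hx.ne', Real.log_mul hx.ne' (Real.Gamma_pos_of_pos hx).ne']

lemma lg_convex : ConvexOn ℝ (Set.Ioi 0) (fun t => Real.log (Real.Gamma t)) :=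
  Real.convexOn_log_Gamma

lemma digamma_add_one {x : ℝ} (hx : 0 < x) : digamma (x + 1) = digamma x + 1 / x := by
  unfold digamma
  rw [← deriv_comp_add_const (fun t => Real.log (Real.Gamma t)) 1 x]
  have h : (fun t => Real.log (Real.Gamma (t + 1))) =ᶠ[nhds x]
      (fun t => Real.log (Real.Gamma t) + Real.log t) := by
    filter_upwards [Ioi_mem_nhds hx] with t ht
    rw [lg_add_one ht, add_comm]
  rw [h.deriv_eq, deriv_fun_add (lg_diff hx) (Real.differentiableAt_log hx.ne'), Real.deriv_log,
    one_div]

lemma digamma_le_log {x : ℝ} (hx : 0 < x) : digamma x ≤ Real.log x := by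
  have h := lg_convex.deriv_le_slope (x := x) (y := x + 1) hx
    (show (0 : ℝ) < x + 1 by linarith) (by linarith) (lg_diff hx)
  rw [slope_def_field, lg_add_one hx] at h
  unfold digamma
  simpa using h

lemma log_le_digamma {x : ℝ} (hx : 0 < x) : Real.log x ≤ digamma (x + 1) := by
  have h := lg_convex.slope_le_deriv (x := x) (y := x + 1) hx
    (show (0 : ℝ) < x + 1 by linarith) (by linarith) (lg_diff (by linarith))
  rw [slope_def_field, lg_add_one hx] at h
  unfold digamma
  simpa using h

lemma log_step {a b : ℝ} (ha : 0 < a) (hab : a < b) :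
    Real.log (a + 1) - Real.log a - (Real.log (b + 1) - Real.log b) < 1 / a - 1 / b := by
  have hb : 0 < b := ha.trans hab
  have h1 : Real.log ((a + 1) * b / (a * (b + 1))) =
      Real.log (a + 1) - Real.log a - (Real.log (b + 1) - Real.log b) := by
    rw [Real.log_div (by positivity) (by positivity), Real.log_mul (by positivity) (by positivity),
      Real.log_mul (by positivity) (by positivity)]
    ring
  have h2 := Real.log_le_sub_one_of_pos (show 0 < (a + 1) * b / (a * (b + 1)) by positivity)
  have h3 : (a + 1) * b / (a * (b + 1)) - 1 = (b - a) / (a * (b + 1)) := by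
    field_simp
    ring
  have h4 : 1 / a - 1 / b = (b - a) / (a * b) := by
    field_simp
  have h5 : (b - a) / (a * (b + 1)) < (b - a) / (a * b) := by
    apply div_lt_div_of_pos_left (by linarith) (by positivity)
    nlinarith
  linarith

/-- The function `log - ψ`. -/
noncomputable def gaux (x : ℝ) : ℝ := Real.log x - digamma x

lemma gaux_step {a b : ℝ} (ha : 0 < a) (hab : a < b) :
    gaux (a + 1) - gaux (b + 1) < gaux a - gaux b := by
  have := log_step ha hab
  unfold gaux
  rw [digamma_add_one ha, digamma_add_one (ha.trans hab)]
  linarith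

lemma gaux_iter {a b : ℝ} (ha : 0 < a) (hab : a < b) (n : ℕ) :
    gaux (a + n) - gaux (b + n) ≤ gaux a - gaux b := by
  induction n with
  | zero => simp
  | succ n ih =>
    have h := gaux_step (a := a + n) (b := b + n) (by positivity) (by linarith)
    push_cast
    rw [← add_assoc, ← add_assoc]
    linarith

lemma gaux_upper {x : ℝ} (hx : 0 < x) : gaux (x + 1) ≤ 1 / x := by
  have h1 := log_le_digamma hx
  have h2 := Real.log_le_sub_one_of_pos (show 0 < (x + 1) / x by positivity)
  rw [Real.log_div (by positivity) (by positivity)] at h2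
  have h3 : (x + 1) / x - 1 = 1 / x := by
    field_simp
    ring
  unfold gaux
  linarith

lemma gaux_le {a b : ℝ} (ha : 0 < a) (hab : a < b) : gaux b ≤ gaux a := by
  have hb : 0 < b := ha.trans hab
  apply le_of_forall_pos_le_add
  intro ε hε
  obtain ⟨n, hn⟩ := exists_nat_gt (1 / ε)
  have h := gaux_iter ha hab (n + 1)
  push_cast at h
  rw [← add_assoc, ← add_assoc] at h
  have hbn : 0 < b + n := by positivity
  have h1 := gaux_upper hbn
  have h2 : 0 ≤ gaux (a + n + 1) := sub_nonneg.2 (digamma_le_log (by positivity))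
  have h3 : 1 / (b + n) < ε := by
    rw [one_div_lt hbn hε]
    linarith
  linarith

lemma gaux_lt {a b : ℝ} (ha : 0 < a) (hab : a < b) : gaux b < gaux a := by
  have h1 := gaux_step ha hab
  have h2 := gaux_le (a := a + 1) (b := b + 1) (by linarith) (by linarith)
  linarith

lemma term_lt {x y k : ℝ} (hk : 0 ≤ k) (hx : k < x) (hxy : x < y) :
    Real.log (y / 2) - digamma ((y - k) / 2) < Real.log (x / 2) - digamma ((x - k) / 2) := by
  have h := gaux_lt (a := (x - k) / 2) (b := (y - k) / 2) (by linarith) (by linarith)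
  unfold gaux at h
  have hx' : 0 < x - k := by linarith
  have hy' : 0 < y - k := by linarith
  have hx0 : 0 < x := by linarith
  have hy0 : 0 < y := by linarith
  have h2 : Real.log (y / 2 * ((x - k) / 2)) ≤ Real.log (x / 2 * ((y - k) / 2)) := by
    apply Real.log_le_log (by positivity)
    nlinarith
  rw [Real.log_mul (by positivity) (by positivity),
    Real.log_mul (by positivity) (by positivity)] at h2
  linarith

theorem rFun_strictAnti (d : ℕ) (hd : 1 ≤ d) :
    ∀ x y : ℝ, (d : ℝ) - 1 < x → x < y → rFun d y < rFun d x := by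
  intro x y hx hxy
  have key : ∀ z : ℝ, rFun d z =
      ∑ j ∈ Finset.Icc 1 d, (Real.log (z / 2) - digamma ((z - j + 1) / 2)) := by
    intro z
    rw [Finset.sum_sub_distrib]
    simp [rFun]
  rw [key, key]
  apply Finset.sum_lt_sum_of_nonempty (Finset.nonempty_Icc.2 hd)
  intro j hj
  obtain ⟨h1, h2⟩ := Finset.mem_Icc.1 hj
  have h1' : (1 : ℝ) ≤ j := by exact_mod_cast h1
  have h2' : (j : ℝ) ≤ d := by exact_mod_cast h2
  have := term_lt (x := x) (y := y) (k := (j : ℝ) - 1) (by linarith) (by linarith) hxy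
  rwa [sub_sub_eq_add_sub, sub_sub_eq_add_sub, add_sub_right_comm, add_sub_right_comm] at this
end

section
/- Let d ≥ 1 and n ≥ d+1 be integers. Let Y_1, …, Y_n be i.i.d. standard Gaussian random vectors in ℝ^d, let Ȳ := (1/n) ∑_{i=1}^n Y_i and Ŝ_n := (1/n) ∑_{i=1}^n (Y_i − Ȳ)(Y_i − Ȳ)ᵀ. Then the expected reverse KL risk of the full Gaussian MLE equals E[ (1/2)(tr(Ŝ_n) + ‖Ȳ‖² − d − log det Ŝ_n) ] = (1/2)·( d·log(n/2) − ∑_{j=1}^d ψ((n−j)/2) ). -/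
open MeasureTheory ProbabilityTheory Matrix

/-- Sample mean `Ȳ = (1/n) ∑ Y_i`. -/
noncomputable def sampleMean (n d : ℕ) (Y : Fin n → Fin d → ℝ) : Fin d → ℝ :=
  ((n : ℝ)⁻¹) • ∑ i : Fin n, Y i

/-- Centered empirical covariance `Ŝ_n = (1/n) ∑ (Y_i - Ȳ)(Y_i - Ȳ)ᵀ`. -/
noncomputable def empCov (n d : ℕ) (Y : Fin n → Fin d → ℝ) :
    Matrix (Fin d) (Fin d) ℝ :=
  ((n : ℝ)⁻¹) • ∑ i : Fin n,
    vecMulVec (Y i - sampleMean n d Y) (Y i - sampleMean n d Y)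


section RadialPart

open Set

lemma aux_logGamma_integrable {s : ℝ} (hs : 0 < s) :
    IntegrableOn (fun t : ℝ => t ^ (s - 1) * Real.exp (-t) * Real.log t) (Ioi 0) := by
  have h : MellinConvergent (fun t : ℝ => Real.log t • ((Real.exp (-t) : ℝ) : ℂ)) (s : ℂ) := by
    refine (mellin_hasDerivAt_of_isBigO_rpow (E := ℂ) (a := s + 1) (b := 0) ?_ ?_ (by simp) ?_
      (by simpa using hs)).1
    · refine (Continuous.continuousOn ?_).locallyIntegrableOn measurableSet_Ioi
      exact Complex.continuous_ofReal.comp (Real.continuous_exp.comp continuous_neg)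
    · rw [← Asymptotics.isBigO_norm_left]
      simp_rw [Complex.norm_real, Asymptotics.isBigO_norm_left]
      simpa only [neg_one_mul] using (isLittleO_exp_neg_mul_rpow_atTop zero_lt_one _).isBigO
    · simp_rw [neg_zero, Real.rpow_zero]
      refine Asymptotics.isBigO_const_of_tendsto (y := (1 : ℂ)) ?_ one_ne_zero
      rw [(by simp : (1 : ℂ) = Real.exp (-0))]
      exact (Complex.continuous_ofReal.comp
        (Real.continuous_exp.comp continuous_neg)).continuousWithinAt
  have h2 := Integrable.re h
  refine (integrableOn_congr_fun ?_ measurableSet_Ioi).mp h2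
  intro t ht
  have ht' : (0 : ℝ) < t := ht
  have : ((t : ℂ) ^ ((s : ℂ) - 1)) = ((t ^ (s - 1) : ℝ) : ℂ) := by
    rw [Complex.ofReal_cpow ht'.le]; push_cast; rfl
  simp only [this, RCLike.re_to_complex, smul_eq_mul, Complex.real_smul, ← Complex.ofReal_mul,
    Complex.ofReal_re]
  ring

lemma aux_logGamma_integral {s : ℝ} (hs : 0 < s) :
    ∫ t in Ioi (0 : ℝ), t ^ (s - 1) * Real.exp (-t) * Real.log t
      = Real.Gamma s * digamma s := by
  have h1 := Complex.hasDerivAt_GammaIntegral (s := (s : ℂ)) (by simpa using hs)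
  have h2 : HasDerivAt Complex.Gamma
      (∫ t : ℝ in Ioi 0, (t : ℂ) ^ ((s : ℂ) - 1) * (Real.log t * Real.exp (-t))) (s : ℂ) := by
    refine h1.congr_of_eventuallyEq ?_
    have : {z : ℂ | 0 < z.re} ∈ nhds (s : ℂ) :=
      (isOpen_lt continuous_const Complex.continuous_re).mem_nhds (by simpa using hs)
    filter_upwards [this] with z hz
    exact Complex.Gamma_eq_integral hz
  have h3 : (∫ t : ℝ in Ioi 0, (t : ℂ) ^ ((s : ℂ) - 1) * (Real.log t * Real.exp (-t)))
      = ((∫ t in Ioi (0 : ℝ), t ^ (s - 1) * Real.exp (-t) * Real.log t : ℝ) : ℂ) := by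
    rw [← integral_complex_ofReal]
    refine setIntegral_congr_fun measurableSet_Ioi ?_
    intro t ht
    have ht' : (0 : ℝ) < t := ht
    have : ((t : ℂ) ^ ((s : ℂ) - 1)) = ((t ^ (s - 1) : ℝ) : ℂ) := by
      rw [Complex.ofReal_cpow ht'.le]; push_cast; rfl
    simp only [this]
    push_cast
    ring
  rw [h3] at h2
  have h4 := h2.real_of_complex
  simp only [Complex.ofReal_re] at h4
  have h5 : HasDerivAt Real.Gamma
      (∫ t in Ioi (0 : ℝ), t ^ (s - 1) * Real.exp (-t) * Real.log t) s := h4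
  have h6 := (h5.log (Real.Gamma_pos_of_pos hs).ne').deriv
  have : digamma s = _ := h6
  rw [this]
  field_simp [(Real.Gamma_pos_of_pos hs).ne']

variable {E : Type*} [NormedAddCommGroup E] [InnerProductSpace ℝ E] [FiniteDimensional ℝ E]
  [MeasurableSpace E] [BorelSpace E]

lemma aux_stdGaussian_density : ∃ c : NNReal, stdGaussian E =
    (volume : Measure E).withDensity (fun x => ((c * Real.toNNReal (Real.exp (-(‖x‖ ^ 2 / 2))) : NNReal) : ENNReal)) := by
  set k : ℝ := (2 * Real.pi) ^ ((Module.finrank ℝ E : ℝ) / 2) with hk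
  have hk0 : 0 < k := by positivity
  set c : NNReal := Real.toNNReal (k⁻¹) with hc
  refine ⟨c, ?_⟩
  have hcv : (c : ℝ) = k⁻¹ := Real.coe_toNNReal _ (by positivity)
  have key : ∀ w : E, ∫ x : E, Complex.exp (inner ℝ x w * Complex.I)
      ∂((volume : Measure E).withDensity (fun x => ((c * Real.toNNReal (Real.exp (-(‖x‖ ^ 2 / 2))) : NNReal) : ENNReal)))
      = Complex.exp (-‖w‖ ^ 2 / 2) := by
    intro w
    rw [integral_withDensity_eq_integral_smul (by fun_prop)]
    have h := GaussianFourier.integral_cexp_neg_mul_sq_norm_add (V := E) (b := (1 / 2 : ℂ))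
      (by norm_num) Complex.I w
    have e1 : ∀ x : E, (c * Real.toNNReal (Real.exp (-(‖x‖ ^ 2 / 2))) : NNReal) •
        Complex.exp (inner ℝ x w * Complex.I) = (k⁻¹ : ℂ) *
        Complex.exp (-(1 / 2 : ℂ) * ‖x‖ ^ 2 + Complex.I * inner ℝ w x) := by
      intro x
      rw [NNReal.smul_def, NNReal.coe_mul, hcv, Real.coe_toNNReal _ (Real.exp_pos _).le,
        Complex.real_smul, Complex.exp_add, real_inner_comm]
      push_cast
      rw [mul_assoc]
      congr 2
      · congr 1; ring
      · congr 1; ring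
    simp_rw [e1]
    rw [integral_const_mul, h]
    have e2 : ((Real.pi : ℂ) / (1 / 2)) ^ ((Module.finrank ℝ E : ℂ) / 2) = (k : ℂ) := by
      rw [hk, Complex.ofReal_cpow (by positivity)]
      push_cast
      congr 1; ring
    rw [e2, ← mul_assoc, inv_mul_cancel₀ (by exact_mod_cast hk0.ne'), one_mul, Complex.I_sq]
    congr 1; ring
  have hfin : IsFiniteMeasure ((volume : Measure E).withDensity (fun x => ((c * Real.toNNReal (Real.exp (-(‖x‖ ^ 2 / 2))) : NNReal) : ENNReal))) := by
    refine isFiniteMeasure_withDensity ?_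
    have h := (GaussianFourier.integrable_cexp_neg_mul_sq_norm_add (V := E) (b := (1 / 2 : ℂ))
      (by norm_num) 0 0).norm.const_mul k⁻¹
    have h' := h.lintegral_lt_top
    refine (lt_of_le_of_lt (le_of_eq ?_) h').ne
    refine lintegral_congr fun x => ?_
    rw [← ENNReal.ofReal_coe_nnreal, NNReal.coe_mul, hcv, Real.coe_toNNReal _ (Real.exp_pos _).le]
    congr 2
    rw [Complex.norm_exp]
    congr 1
    simp [← Complex.ofReal_pow]
    ring
  refine Measure.ext_of_charFun ?_
  ext w
  rw [charFun_stdGaussian, charFun_apply, key]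

lemma aux_radial [Nontrivial E] : ∃ K : ℝ, ∀ f : ℝ → ℝ,
    (Integrable (fun x : E => f (‖x‖ ^ 2 / 2)) (stdGaussian E) ↔
      K = 0 ∨ IntegrableOn (fun t : ℝ => t ^ ((Module.finrank ℝ E : ℝ) / 2 - 1) * Real.exp (-t) * f t) (Ioi 0)) ∧
    ∫ x : E, f (‖x‖ ^ 2 / 2) ∂(stdGaussian E) =
      K * ∫ t in Ioi (0 : ℝ), t ^ ((Module.finrank ℝ E : ℝ) / 2 - 1) * Real.exp (-t) * f t := by
  obtain ⟨c, hc⟩ := aux_stdGaussian_density (E := E)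
  set m := Module.finrank ℝ E with hm
  have hm1 : 1 ≤ m := Module.finrank_pos
  have hcne : (c : ℝ) ≠ 0 := by
    intro h
    have h0 : c = 0 := by exact_mod_cast h
    have h1 : stdGaussian E univ = 1 := measure_univ
    rw [hc, h0] at h1
    simp at h1
  -- substitution
  set q : ℝ := 2 ^ ((m : ℝ) / 2 - 1) with hq
  have hqpos : 0 < q := by positivity
  have sub : ∀ f : ℝ → ℝ, ∀ r ∈ Ioi (0 : ℝ),
      r ^ (m - 1) • ((c * Real.exp (-(r ^ 2 / 2))) * f (r ^ 2 / 2)) =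
      (c * q / 2) * ((|(2 : ℝ)| * r ^ ((2 : ℝ) - 1)) • (fun u : ℝ => (fun t : ℝ => t ^ ((m : ℝ) / 2 - 1) * Real.exp (-t) * f t) (2⁻¹ * u)) (r ^ (2 : ℝ))) := by
    intro f r hr
    have hr' : (0 : ℝ) < r := hr
    have e0 : r ^ (2 : ℝ) = r ^ 2 := by exact_mod_cast Real.rpow_natCast r 2
    have e1 : (2 : ℝ)⁻¹ * r ^ 2 = r ^ 2 / 2 := by ring
    have e2 : (r ^ 2 / 2) ^ ((m : ℝ) / 2 - 1) = r ^ ((m : ℝ) - 2) / q := by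
      rw [Real.div_rpow (by positivity) (by norm_num), ← e0, ← Real.rpow_mul hr'.le, hq]
      congr 2; ring
    have e3 : r ^ (m - 1) = r ^ ((m : ℝ) - 2) * r := by
      rw [← Real.rpow_natCast, ← Real.rpow_add_one hr'.ne', Nat.cast_sub hm1]
      congr 1; push_cast; ring
    have e4 : r ^ ((2 : ℝ) - 1) = r := by norm_num
    simp only [e0, e1, e2, e3, e4, smul_eq_mul, abs_of_pos (show (0 : ℝ) < 2 by norm_num)]
    field_simp
  refine ⟨m * (volume : Measure E).real (Metric.ball 0 1) * (c * q), fun f => ⟨?_, ?_⟩⟩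
  · have hKne : ¬ (m * (volume : Measure E).real (Metric.ball 0 1) * (c * q) = 0) := by
      have : 0 < (volume : Measure E).real (Metric.ball 0 1) :=
        ENNReal.toReal_pos (Metric.measure_ball_pos _ _ one_pos).ne' measure_ball_lt_top.ne
      have : (0 : ℝ) < m := by exact_mod_cast hm1
      positivity
    rw [or_iff_right hKne, hc, integrable_withDensity_iff_integrable_smul (by fun_prop)]
    have := integrable_fun_norm_addHaar (volume : Measure E)
      (f := fun r => (c * Real.exp (-(r ^ 2 / 2))) * f (r ^ 2 / 2))
    have e : ∀ x : E, (c * Real.toNNReal (Real.exp (-(‖x‖ ^ 2 / 2))) : NNReal) • f (‖x‖ ^ 2 / 2)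
        = (c * Real.exp (-(‖x‖ ^ 2 / 2))) * f (‖x‖ ^ 2 / 2) := by
      intro x
      rw [NNReal.smul_def, NNReal.coe_mul, Real.coe_toNNReal _ (Real.exp_pos _).le, smul_eq_mul]
    simp_rw [e]
    rw [this, integrableOn_congr_fun (sub f) measurableSet_Ioi]
    rw [IntegrableOn, integrable_const_mul_iff (by simp [hcne, hqpos.ne'] : IsUnit ((c : ℝ) * q / 2)),
      ← IntegrableOn, integrableOn_Ioi_comp_rpow_iff
        (fun u : ℝ => (fun t : ℝ => t ^ ((m : ℝ) / 2 - 1) * Real.exp (-t) * f t) (2⁻¹ * u)) (two_ne_zero' ℝ),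
      integrableOn_Ioi_comp_mul_left_iff (fun t : ℝ => t ^ ((m : ℝ) / 2 - 1) * Real.exp (-t) * f t) _ (by norm_num : (0 : ℝ) < 2⁻¹), mul_zero]
  · rw [hc, integral_withDensity_eq_integral_smul (by fun_prop)]
    have := integral_fun_norm_addHaar (volume : Measure E)
      (f := fun r => (c * Real.exp (-(r ^ 2 / 2))) * f (r ^ 2 / 2))
    have e : ∀ x : E, (c * Real.toNNReal (Real.exp (-(‖x‖ ^ 2 / 2))) : NNReal) • f (‖x‖ ^ 2 / 2)
        = (c * Real.exp (-(‖x‖ ^ 2 / 2))) * f (‖x‖ ^ 2 / 2) := by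
      intro x
      rw [NNReal.smul_def, NNReal.coe_mul, Real.coe_toNNReal _ (Real.exp_pos _).le, smul_eq_mul]
    simp_rw [e]
    rw [this, setIntegral_congr_fun measurableSet_Ioi (sub f), integral_const_mul,
      integral_comp_rpow_Ioi
        (fun u : ℝ => (fun t : ℝ => t ^ ((m : ℝ) / 2 - 1) * Real.exp (-t) * f t) (2⁻¹ * u)) (two_ne_zero' ℝ),
      integral_comp_mul_left_Ioi (fun t : ℝ => t ^ ((m : ℝ) / 2 - 1) * Real.exp (-t) * f t) _ (by norm_num : (0 : ℝ) < 2⁻¹), mul_zero]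
    simp only [nsmul_eq_mul, smul_eq_mul, inv_inv]
    ring

lemma aux_ae_ne_zero [Nontrivial E] : ∀ᵐ x ∂(stdGaussian E), x ≠ 0 := by
  obtain ⟨c, hc⟩ := aux_stdGaussian_density (E := E)
  have : stdGaussian E ≪ volume := by rw [hc]; exact withDensity_absolutelyContinuous _ _
  refine this.ae_le ?_
  exact compl_mem_ae_iff.mpr (measure_singleton 0)

lemma aux_log_norm [Nontrivial E] :
    Integrable (fun x : E => Real.log (‖x‖ ^ 2)) (stdGaussian E) ∧
    ∫ x : E, Real.log (‖x‖ ^ 2) ∂(stdGaussian E) =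
      Real.log 2 + digamma ((Module.finrank ℝ E : ℝ) / 2) := by
  obtain ⟨K, hK⟩ := aux_radial (E := E)
  have hm1 : 0 < Module.finrank ℝ E := Module.finrank_pos
  have hs : 0 < (Module.finrank ℝ E : ℝ) / 2 := by positivity
  have h1 := (hK (fun _ => 1)).2
  simp only [integral_const, probReal_univ, smul_eq_mul, mul_one] at h1
  have hG := Real.Gamma_eq_integral hs
  have hG' : ∫ t in Ioi (0 : ℝ), t ^ ((Module.finrank ℝ E : ℝ) / 2 - 1) * Real.exp (-t)
      = Real.Gamma ((Module.finrank ℝ E : ℝ) / 2) := by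
    rw [hG]; congr 1; ext t; ring
  rw [hG'] at h1
  have hi := (hK Real.log).1.mpr (Or.inr (aux_logGamma_integrable hs))
  have hv := (hK Real.log).2
  rw [aux_logGamma_integral hs, ← mul_assoc, ← h1, one_mul] at hv
  have hne := aux_ae_ne_zero (E := E)
  have he : (fun x : E => Real.log (‖x‖ ^ 2)) =ᵐ[stdGaussian E]
      fun x => Real.log 2 + Real.log (‖x‖ ^ 2 / 2) := by
    filter_upwards [hne] with x hx
    have : ‖x‖ ≠ 0 := by simpa using hx
    rw [Real.log_div (by positivity) (by norm_num)]; ring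
  refine ⟨((integrable_const _).add hi).congr he.symm, ?_⟩
  rw [integral_congr_ae he, integral_add (integrable_const _) hi, hv]
  simp

end RadialPart

section GramPart

variable {E : Type*} [NormedAddCommGroup E] [InnerProductSpace ℝ E]

lemma aux_det_gram_cons [FiniteDimensional ℝ E] {k : ℕ} (v : Fin k → E) (x : E) :
    (Matrix.gram ℝ (Fin.cons x v : Fin (k + 1) → E)).det =
      ‖(Submodule.span ℝ (Set.range v))ᗮ.orthogonalProjectionOnto x‖ ^ 2 * (Matrix.gram ℝ v).det := by
  set U := Submodule.span ℝ (Set.range v) with hU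
  set w : Fin (k + 1) → E := Fin.cons x v with hw
  set A := Matrix.gram ℝ w with hA
  let L : E →ₗ[ℝ] ℝ :=
    { toFun := fun y => (A.updateRow 0 (fun j => inner ℝ y (w j))).det
      map_add' := by
        intro y z
        rw [← Matrix.det_updateRow_add]
        congr 2; ext j; simp [inner_add_left]
      map_smul' := by
        intro a y
        rw [RingHom.id_apply, smul_eq_mul, ← Matrix.det_updateRow_smul]
        congr 2; ext j; simp [inner_smul_left] }
  have hLv : ∀ y ∈ U, L y = 0 := by
    intro y hy
    have : U ≤ LinearMap.ker L := by
      rw [hU, Submodule.span_le]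
      rintro _ ⟨i, rfl⟩
      change L (v i) = 0
      refine Matrix.det_zero_of_row_eq (i := 0) (j := i.succ) (Fin.succ_ne_zero i).symm ?_
      ext j
      simp [Matrix.updateRow_apply, hA, hw]
    exact this hy
  have hLx : A.det = L x := by
    change _ = (A.updateRow 0 (fun j => inner ℝ x (w j))).det
    congr 1
    ext i j
    refine Fin.cases ?_ (fun i => ?_) i
    · simp [hA, hw]
    · simp
  set q : E := (Uᗮ.orthogonalProjectionOnto x : E) with hq
  have hqU : q ∈ Uᗮ := Submodule.coe_mem _
  have hxq : L x = L q := by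
    have : x - q ∈ U := by
      have := Submodule.sub_starProjection_mem_orthogonal (K := Uᗮ) x
      rwa [Submodule.orthogonal_orthogonal] at this
    have h := hLv _ this
    rw [map_sub] at h
    linarith
  rw [hLx, hxq]
  change (A.updateRow 0 (fun j => inner ℝ q (w j))).det = _
  rw [Matrix.det_succ_row_zero, Fin.sum_univ_succ]
  have hz : ∀ i : Fin k, inner ℝ q (v i) = 0 := fun i =>
    Submodule.inner_left_of_mem_orthogonal (Submodule.subset_span (Set.mem_range_self i)) hqU
  have hqx : inner ℝ q x = ‖Uᗮ.orthogonalProjectionOnto x‖ ^ 2 := by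
    have h1 : inner ℝ q (x - q) = 0 := by
      have := Submodule.sub_starProjection_mem_orthogonal (K := Uᗮ) x
      exact Submodule.inner_right_of_mem_orthogonal hqU this
    rw [inner_sub_right, real_inner_self_eq_norm_sq] at h1
    have : ‖q‖ = ‖Uᗮ.orthogonalProjectionOnto x‖ := rfl
    rw [← this]; linarith
  have hsub : (A.updateRow 0 (fun j => inner ℝ q (w j))).submatrix Fin.succ (Fin.succAbove 0)
      = Matrix.gram ℝ v := by
    ext i j
    simp [hA, hw, Matrix.updateRow_apply]
  rw [hsub]
  simp [hw, hz, hqx]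

lemma aux_proj_law [FiniteDimensional ℝ E] [MeasurableSpace E] [BorelSpace E]
    (U : Submodule ℝ E) :
    (stdGaussian E).map (fun x => U.orthogonalProjectionOnto x) = stdGaussian U := by
  have hmeas : Measurable (fun x => U.orthogonalProjectionOnto x) :=
    U.orthogonalProjectionOnto.continuous.measurable
  have : IsProbabilityMeasure ((stdGaussian E).map (fun x => U.orthogonalProjectionOnto x)) :=
    Measure.isProbabilityMeasure_map hmeas.aemeasurable
  refine Measure.ext_of_charFun ?_
  ext t
  rw [charFun_stdGaussian, charFun_apply, integral_map hmeas.aemeasurable (by fun_prop)]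
  have h := charFun_stdGaussian (E := E) (t : E)
  rw [charFun_apply] at h
  have e : ∀ x : E, inner ℝ (U.orthogonalProjectionOnto x) t = inner ℝ x (t : E) := by
    intro x
    rw [← Submodule.inner_orthogonalProjectionOnto_eq_of_mem_right]
  simp_rw [e]
  rw [h]
  simp

end GramPart

section WishartPart

variable {E : Type*} [NormedAddCommGroup E] [InnerProductSpace ℝ E] [FiniteDimensional ℝ E]
  [MeasurableSpace E] [BorelSpace E]

/-- The `L¹` norm of `log ‖x‖²` in dimension `r`. -/
noncomputable def auxC (r : ℕ) : ℝ :=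
  ∫ x : EuclideanSpace ℝ (Fin r), ‖Real.log (‖x‖ ^ 2)‖ ∂(stdGaussian (EuclideanSpace ℝ (Fin r)))

lemma aux_abs_log_norm : ∫ x : E, ‖Real.log (‖x‖ ^ 2)‖ ∂(stdGaussian E)
    = auxC (Module.finrank ℝ E) := by
  have h := stdGaussian_map (E := E) (stdOrthonormalBasis ℝ E).repr
  rw [auxC, ← h, integral_map]
  · simp
  · exact (LinearIsometryEquiv.continuous _).measurable.aemeasurable
  · exact Measurable.aestronglyMeasurable (by fun_prop)

lemma aux_continuous_det_gram (k : ℕ) :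
    Continuous (fun v : Fin k → E => (Matrix.gram ℝ v).det) := by
  refine Continuous.matrix_det ?_
  refine continuous_matrix fun i j => ?_
  simp only [Matrix.gram_apply]
  fun_prop

lemma aux_mp_cons (k : ℕ) : MeasurePreserving
    (fun p : (Fin k → E) × E => (Fin.cons p.2 p.1 : Fin (k + 1) → E))
    ((Measure.pi fun _ : Fin k => stdGaussian E).prod (stdGaussian E))
    (Measure.pi fun _ : Fin (k + 1) => stdGaussian E) := by
  have h := (measurePreserving_piFinSuccAbove (fun _ : Fin (k + 1) => stdGaussian E) 0).symm
  have h2 := h.comp (Measure.measurePreserving_swap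
    (μ := Measure.pi fun _ : Fin k => stdGaussian E) (ν := stdGaussian E))
  convert h2 using 1
  ext p i
  simp [MeasurableEquiv.piFinSuccAbove, Fin.insertNthEquiv]

lemma aux_slice {k : ℕ} (hk : k + 1 ≤ Module.finrank ℝ E) (v : Fin k → E)
    (hv : LinearIndependent ℝ v) :
    (∀ᵐ x ∂(stdGaussian E), (Matrix.gram ℝ (Fin.cons x v : Fin (k + 1) → E)).det ≠ 0) ∧
    Integrable (fun x => Real.log (Matrix.gram ℝ (Fin.cons x v : Fin (k + 1) → E)).det
      - Real.log (Matrix.gram ℝ v).det) (stdGaussian E) ∧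
    ∫ x, (Real.log (Matrix.gram ℝ (Fin.cons x v : Fin (k + 1) → E)).det
      - Real.log (Matrix.gram ℝ v).det) ∂(stdGaussian E) =
      Real.log 2 + digamma (((Module.finrank ℝ E : ℝ) - k) / 2) ∧
    ∫ x, ‖Real.log (Matrix.gram ℝ (Fin.cons x v : Fin (k + 1) → E)).det
      - Real.log (Matrix.gram ℝ v).det‖ ∂(stdGaussian E) = auxC (Module.finrank ℝ E - k) := by
  set U := Submodule.span ℝ (Set.range v) with hU
  have hrU : Module.finrank ℝ U = k := by
    rw [hU, finrank_span_eq_card hv, Fintype.card_fin]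
  have hr : Module.finrank ℝ Uᗮ = Module.finrank ℝ E - k := by
    have := Submodule.finrank_add_finrank_orthogonal U
    omega
  have hnt : Nontrivial Uᗮ := Module.nontrivial_of_finrank_pos (R := ℝ) (by omega)
  have hdet := Matrix.det_gram_ne_zero_iff_linearIndependent.mpr hv
  have hmeas : Measurable (fun x => Uᗮ.orthogonalProjectionOnto x) :=
    Uᗮ.orthogonalProjectionOnto.continuous.measurable
  have hlaw := aux_proj_law Uᗮ
  have hne : ∀ᵐ x ∂(stdGaussian E), Uᗮ.orthogonalProjectionOnto x ≠ 0 := by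
    have := aux_ae_ne_zero (E := Uᗮ)
    rw [← hlaw] at this
    exact ae_of_ae_map hmeas.aemeasurable this
  have heq : (fun x => Real.log (Matrix.gram ℝ (Fin.cons x v : Fin (k + 1) → E)).det
      - Real.log (Matrix.gram ℝ v).det) =ᵐ[stdGaussian E]
      fun x => Real.log (‖Uᗮ.orthogonalProjectionOnto x‖ ^ 2) := by
    filter_upwards [hne] with x hx
    have : ‖Uᗮ.orthogonalProjectionOnto x‖ ≠ 0 := norm_ne_zero_iff.mpr hx
    rw [aux_det_gram_cons, Real.log_mul (by positivity) hdet]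
    ring
  obtain ⟨hi, hint⟩ := aux_log_norm (E := Uᗮ)
  have hs : AEStronglyMeasurable (fun x : Uᗮ => Real.log (‖x‖ ^ 2))
      ((stdGaussian E).map (fun x => Uᗮ.orthogonalProjectionOnto x)) :=
    Measurable.aestronglyMeasurable (by fun_prop)
  refine ⟨?_, ?_, ?_, ?_⟩
  · filter_upwards [hne] with x hx
    have : ‖Uᗮ.orthogonalProjectionOnto x‖ ≠ 0 := norm_ne_zero_iff.mpr hx
    rw [aux_det_gram_cons]
    exact mul_ne_zero (by positivity) hdet
  · rw [integrable_congr heq]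
    rw [← hlaw] at hi
    exact hi.comp_measurable hmeas
  · rw [integral_congr_ae heq]
    rw [← hlaw, integral_map hmeas.aemeasurable hs, hr, Nat.cast_sub (by omega)] at hint
    exact hint
  · have h := aux_abs_log_norm (E := Uᗮ)
    rw [← hlaw, integral_map hmeas.aemeasurable hs.norm, hr] at h
    rw [← h]
    refine integral_congr_ae ?_
    filter_upwards [heq] with x hx
    rw [hx]

lemma aux_wishart (d : ℕ) (hd : d ≤ Module.finrank ℝ E) :
    (∀ᵐ v ∂(Measure.pi fun _ : Fin d => stdGaussian E), LinearIndependent ℝ v) ∧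
    Integrable (fun v : Fin d → E => Real.log (Matrix.gram ℝ v).det)
      (Measure.pi fun _ : Fin d => stdGaussian E) ∧
    ∫ v : Fin d → E, Real.log (Matrix.gram ℝ v).det ∂(Measure.pi fun _ : Fin d => stdGaussian E) =
      ∑ k ∈ Finset.range d, (Real.log 2 + digamma (((Module.finrank ℝ E : ℝ) - k) / 2)) := by
  induction d with
  | zero => simp
  | succ k ih =>
    obtain ⟨ih1, ih2, ih3⟩ := ih (by omega)
    have hmp := aux_mp_cons (E := E) k
    set ν := Measure.pi fun _ : Fin k => stdGaussian E with hν
    have hcont : Continuous (fun p : (Fin k → E) × E =>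
        (Matrix.gram ℝ (Fin.cons p.2 p.1 : Fin (k + 1) → E)).det) := by
      refine (aux_continuous_det_gram (E := E) (k + 1)).comp ?_
      refine continuous_pi fun i => ?_
      refine Fin.cases ?_ (fun i => ?_) i
      · simpa using continuous_snd
      · simp only [Fin.cons_succ]; fun_prop
    have hcont2 : Continuous (fun p : (Fin k → E) × E => (Matrix.gram ℝ p.1).det) :=
      (aux_continuous_det_gram (E := E) k).comp continuous_fst
    have hg1m : AEStronglyMeasurable (fun p : (Fin k → E) × E =>
        Real.log (Matrix.gram ℝ (Fin.cons p.2 p.1 : Fin (k + 1) → E)).det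
          - Real.log (Matrix.gram ℝ p.1).det) (ν.prod (stdGaussian E)) :=
      ((Real.measurable_log.comp hcont.measurable).sub
        (Real.measurable_log.comp hcont2.measurable)).aestronglyMeasurable
    have hg1 : Integrable (fun p : (Fin k → E) × E =>
        Real.log (Matrix.gram ℝ (Fin.cons p.2 p.1 : Fin (k + 1) → E)).det
          - Real.log (Matrix.gram ℝ p.1).det) (ν.prod (stdGaussian E)) := by
      rw [integrable_prod_iff hg1m]
      refine ⟨?_, ?_⟩
      · filter_upwards [ih1] with v hv
        exact (aux_slice hd v hv).2.1
      · refine (integrable_const (auxC (Module.finrank ℝ E - k))).congr ?_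
        filter_upwards [ih1] with v hv
        exact (aux_slice hd v hv).2.2.2.symm
    have hg1v : ∫ p : (Fin k → E) × E,
        (Real.log (Matrix.gram ℝ (Fin.cons p.2 p.1 : Fin (k + 1) → E)).det
          - Real.log (Matrix.gram ℝ p.1).det) ∂(ν.prod (stdGaussian E)) =
          Real.log 2 + digamma (((Module.finrank ℝ E : ℝ) - k) / 2) := by
      rw [integral_prod _ hg1]
      have : (fun v : Fin k → E => ∫ x, (Real.log (Matrix.gram ℝ (Fin.cons x v : Fin (k + 1) → E)).det
          - Real.log (Matrix.gram ℝ v).det) ∂(stdGaussian E)) =ᵐ[ν]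
          fun _ => Real.log 2 + digamma (((Module.finrank ℝ E : ℝ) - k) / 2) := by
        filter_upwards [ih1] with v hv
        exact (aux_slice hd v hv).2.2.1
      rw [integral_congr_ae this]
      simp
    have hg2 : Integrable (fun p : (Fin k → E) × E => Real.log (Matrix.gram ℝ p.1).det)
        (ν.prod (stdGaussian E)) := ih2.comp_fst _
    have hg2v : ∫ p : (Fin k → E) × E, Real.log (Matrix.gram ℝ p.1).det
        ∂(ν.prod (stdGaussian E)) = ∫ v, Real.log (Matrix.gram ℝ v).det ∂ν := by
      rw [integral_prod _ hg2]
      simp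
    have hfm : AEStronglyMeasurable (fun v : Fin (k + 1) → E => Real.log (Matrix.gram ℝ v).det)
        (Measure.pi fun _ : Fin (k + 1) => stdGaussian E) :=
      (Real.measurable_log.comp (aux_continuous_det_gram (E := E) (k + 1)).measurable).aestronglyMeasurable
    refine ⟨?_, ?_, ?_⟩
    · have hset : MeasurableSet {v : Fin (k + 1) → E | (Matrix.gram ℝ v).det ≠ 0} :=
        (isOpen_ne_fun (aux_continuous_det_gram (E := E) (k + 1)) continuous_const).measurableSet
      have h1 : ∀ᵐ v ∂(Measure.pi fun _ : Fin (k + 1) => stdGaussian E),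
          v ∈ {v : Fin (k + 1) → E | (Matrix.gram ℝ v).det ≠ 0} := by
        rw [← hmp.map_eq]
        refine (ae_map_iff hmp.measurable.aemeasurable hset).mpr ?_
        have hset2 : MeasurableSet {p : (Fin k → E) × E |
            (Matrix.gram ℝ (Fin.cons p.2 p.1 : Fin (k + 1) → E)).det ≠ 0} :=
          (isOpen_ne_fun hcont continuous_const).measurableSet
        refine (Measure.ae_prod_mem_iff_ae_ae_mem hset2).mpr ?_
        filter_upwards [ih1] with v hv
        exact (aux_slice hd v hv).1
      filter_upwards [h1] with v hv
      exact Matrix.det_gram_ne_zero_iff_linearIndependent.mp hv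
    · rw [← hmp.map_eq] at hfm ⊢
      rw [integrable_map_measure hfm hmp.measurable.aemeasurable]
      refine (hg1.add hg2).congr (Filter.Eventually.of_forall fun p => ?_)
      simp
    · rw [← hmp.map_eq] at hfm ⊢
      rw [integral_map hmp.measurable.aemeasurable hfm, Finset.sum_range_succ, ← ih3, ← hg2v,
        ← hg1v, ← integral_add hg2 hg1]
      simp

end WishartPart

section FinalPart

lemma aux_transpose (n d : ℕ) :
    MeasurePreserving (fun (Y : Fin n → Fin d → ℝ) (k : Fin d) (i : Fin n) => Y i k)
      (stdGaussianSample n d) (stdGaussianSample d n) := by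
  have hU1 : (Measure.pi fun _ : Fin n × Fin d => gaussianReal 0 1)
      = (stdGaussianSample n d).map (fun Y p => Y p.1 p.2) := by
    refine Measure.pi_eq fun s hs => ?_
    rw [Measure.map_apply (by fun_prop) (MeasurableSet.univ_pi hs)]
    have : (fun (Y : Fin n → Fin d → ℝ) (p : Fin n × Fin d) => Y p.1 p.2) ⁻¹' (Set.univ.pi s)
        = Set.univ.pi (fun i => Set.univ.pi (fun k => s (i, k))) := by
      ext Y; simp
    rw [this, stdGaussianSample, Measure.pi_pi]
    simp_rw [Measure.pi_pi]
    rw [Fintype.prod_prod_type]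
  have hU2 : (Measure.pi fun _ : Fin n × Fin d => gaussianReal 0 1)
      = (stdGaussianSample d n).map (fun Y p => Y p.2 p.1) := by
    refine Measure.pi_eq fun s hs => ?_
    rw [Measure.map_apply (by fun_prop) (MeasurableSet.univ_pi hs)]
    have : (fun (Y : Fin d → Fin n → ℝ) (p : Fin n × Fin d) => Y p.2 p.1) ⁻¹' (Set.univ.pi s)
        = Set.univ.pi (fun k => Set.univ.pi (fun i => s (i, k))) := by
      ext Y
      simp only [Set.mem_preimage, Set.mem_univ_pi, Prod.forall]
      exact forall_comm
    rw [this, stdGaussianSample, Measure.pi_pi]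
    simp_rw [Measure.pi_pi]
    rw [Fintype.prod_prod_type_right]
  refine ⟨by fun_prop, ?_⟩
  have h := congrArg (Measure.map (fun (Z : Fin n × Fin d → ℝ) (k : Fin d) (i : Fin n) => Z (i, k)))
    (hU1.symm.trans hU2)
  rw [Measure.map_map (by fun_prop) (by fun_prop), Measure.map_map (by fun_prop) (by fun_prop)] at h
  rw [show (stdGaussianSample d n) = Measure.map id (stdGaussianSample d n) by simp]
  exact h

/-- The all-ones vector. -/
noncomputable def auxOne (n : ℕ) : EuclideanSpace ℝ (Fin n) := WithLp.toLp 2 (fun _ => 1)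

/-- The hyperplane of centered vectors. -/
noncomputable def auxF (n : ℕ) : Submodule ℝ (EuclideanSpace ℝ (Fin n)) :=
  (Submodule.span ℝ {auxOne n})ᗮ

/-- The projected columns of the sample. -/
noncomputable def auxCols (n d : ℕ) (Y : Fin n → Fin d → ℝ) (k : Fin d) : auxF n :=
  (auxF n).orthogonalProjectionOnto (WithLp.toLp 2 (fun i => Y i k))

lemma aux_finrank (n : ℕ) (hn : 1 ≤ n) : Module.finrank ℝ (auxF n) = n - 1 := by
  have h1 : auxOne n ≠ 0 := by
    intro h
    have := congrArg (fun x : EuclideanSpace ℝ (Fin n) => x ⟨0, hn⟩) h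
    simp [auxOne] at this
  have h2 := Submodule.finrank_add_finrank_orthogonal (Submodule.span ℝ {auxOne n})
  rw [finrank_span_singleton h1, finrank_euclideanSpace_fin] at h2
  change 1 + Module.finrank ℝ (auxF n) = n at h2
  omega

lemma aux_mp_cols (n d : ℕ) : MeasurePreserving (auxCols n d) (stdGaussianSample n d)
    (Measure.pi fun _ : Fin d => stdGaussian (auxF n)) := by
  have h1 : MeasurePreserving (fun x : Fin n → ℝ =>
      (auxF n).orthogonalProjectionOnto (WithLp.toLp 2 x))
      (Measure.pi fun _ : Fin n => gaussianReal 0 1) (stdGaussian (auxF n)) := by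
    have a : MeasurePreserving (fun x : Fin n → ℝ => WithLp.toLp 2 x)
        (Measure.pi fun _ : Fin n => gaussianReal 0 1) (stdGaussian (EuclideanSpace ℝ (Fin n))) :=
      ⟨by fun_prop, map_pi_eq_stdGaussian⟩
    have b : MeasurePreserving (fun x => (auxF n).orthogonalProjectionOnto x)
        (stdGaussian (EuclideanSpace ℝ (Fin n))) (stdGaussian (auxF n)) :=
      ⟨(auxF n).orthogonalProjectionOnto.continuous.measurable, aux_proj_law _⟩
    exact b.comp a
  have h2 := measurePreserving_pi (fun _ : Fin d => Measure.pi fun _ : Fin n => gaussianReal 0 1)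
    (fun _ : Fin d => stdGaussian (auxF n)) (fun _ => h1)
  exact h2.comp (aux_transpose n d)

lemma aux_cols_apply (n d : ℕ) (Y : Fin n → Fin d → ℝ) (k : Fin d) (i : Fin n) :
    (auxCols n d Y k : EuclideanSpace ℝ (Fin n)) i = Y i k - sampleMean n d Y k := by
  have h : (auxCols n d Y k : EuclideanSpace ℝ (Fin n)) =
      WithLp.toLp 2 (fun i => Y i k) -
        (Submodule.span ℝ {auxOne n}).starProjection (WithLp.toLp 2 (fun i => Y i k)) := by
    rw [← Submodule.starProjection_orthogonal_val]
    rfl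
  rw [h, Submodule.starProjection_singleton]
  have e1 : ‖auxOne n‖ ^ 2 = n := by
    simp [auxOne, EuclideanSpace.norm_sq_eq]
  have e2 : inner ℝ (auxOne n) (WithLp.toLp 2 (fun i => Y i k)) = ∑ i, Y i k := by
    simp [auxOne, PiLp.inner_apply]
  rw [e2]
  simp only [RCLike.ofReal_real_eq_id, id]
  rw [e1]
  simp [auxOne, sampleMean]
  ring

lemma aux_empCov (n d : ℕ) (Y : Fin n → Fin d → ℝ) :
    empCov n d Y = ((n : ℝ)⁻¹) • Matrix.gram ℝ (auxCols n d Y) := by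
  rw [empCov]
  congr 1
  ext k l
  rw [Matrix.sum_apply, Matrix.gram_apply, Submodule.coe_inner, PiLp.inner_apply]
  refine Finset.sum_congr rfl fun i _ => ?_
  rw [aux_cols_apply, aux_cols_apply]
  simp [Matrix.vecMulVec_apply]
  ring

lemma aux_trace (n d : ℕ) (hn : 1 ≤ n) (Y : Fin n → Fin d → ℝ) :
    (empCov n d Y).trace + (∑ k : Fin d, (sampleMean n d Y k) ^ 2)
      = ∑ k : Fin d, ∑ i : Fin n, (n : ℝ)⁻¹ * (Y i k) ^ 2 := by
  rw [Matrix.trace, ← Finset.sum_add_distrib]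
  refine Finset.sum_congr rfl fun k _ => ?_
  have hn0 : (n : ℝ) ≠ 0 := by positivity
  have hm : ∑ i, Y i k = n * sampleMean n d Y k := by
    simp [sampleMean]
    field_simp
  rw [Matrix.diag_apply, empCov, Matrix.smul_apply, Matrix.sum_apply]
  simp only [Matrix.vecMulVec_apply, Pi.sub_apply, smul_eq_mul, ← Finset.mul_sum]
  set c := sampleMean n d Y k
  have : ∑ i, (Y i k - c) * (Y i k - c) = ∑ i, (Y i k) ^ 2 - 2 * c * ∑ i, Y i k + n * c ^ 2 := by
    rw [Finset.mul_sum, ← Finset.sum_sub_distrib]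
    have : (n : ℝ) * c ^ 2 = ∑ i : Fin n, c ^ 2 := by simp
    rw [this, ← Finset.sum_add_distrib]
    exact Finset.sum_congr rfl fun i _ => by ring
  rw [this, hm]
  field_simp
  ring

lemma aux_sq_integral : Integrable (fun x : ℝ => x ^ 2) (gaussianReal 0 1) ∧
    ∫ x, x ^ 2 ∂(gaussianReal 0 1) = 1 := by
  have h := memLp_id_gaussianReal (μ := 0) (v := 1) 2
  refine ⟨by simpa using h.integrable_sq, ?_⟩
  have hv := variance_id_gaussianReal (μ := 0) (v := 1)
  rw [variance_of_integral_eq_zero aemeasurable_id (by simp)] at hv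
  simpa using hv

lemma aux_mp_eval (n d : ℕ) (i : Fin n) (k : Fin d) :
    MeasurePreserving (fun Y : Fin n → Fin d → ℝ => Y i k) (stdGaussianSample n d)
      (gaussianReal 0 1) :=
  (measurePreserving_eval (fun _ : Fin d => gaussianReal 0 1) k).comp
    (measurePreserving_eval (fun _ : Fin n => Measure.pi fun _ : Fin d => gaussianReal 0 1) i)

lemma aux_trace_integral (n d : ℕ) (hn : 1 ≤ n) :
    Integrable (fun Y => (empCov n d Y).trace + (∑ k : Fin d, (sampleMean n d Y k) ^ 2))
      (stdGaussianSample n d) ∧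
    ∫ Y, ((empCov n d Y).trace + (∑ k : Fin d, (sampleMean n d Y k) ^ 2))
      ∂(stdGaussianSample n d) = d := by
  simp_rw [aux_trace n d hn]
  have hi : ∀ (k : Fin d) (i : Fin n),
      Integrable (fun Y : Fin n → Fin d → ℝ => (n : ℝ)⁻¹ * (Y i k) ^ 2) (stdGaussianSample n d) :=
    fun k i => ((aux_mp_eval n d i k).integrable_comp_of_integrable aux_sq_integral.1).const_mul _
  have hv : ∀ (k : Fin d) (i : Fin n),
      ∫ Y, (Y i k) ^ 2 ∂(stdGaussianSample n d) = 1 := by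
    intro k i
    have h := integral_map (μ := stdGaussianSample n d) (aux_mp_eval n d i k).measurable.aemeasurable (f := fun x : ℝ => x ^ 2)
      (Measurable.aestronglyMeasurable (by fun_prop))
    rw [(aux_mp_eval n d i k).map_eq, aux_sq_integral.2] at h
    exact h.symm
  refine ⟨integrable_finsetSum _ fun k _ => integrable_finsetSum _ fun i _ => hi k i, ?_⟩
  rw [integral_finsetSum _ fun k _ => integrable_finsetSum _ fun i _ => hi k i]
  have hn0 : (n : ℝ) ≠ 0 := by positivity
  have : ∀ k : Fin d, ∫ Y, ∑ i : Fin n, (n : ℝ)⁻¹ * (Y i k) ^ 2 ∂(stdGaussianSample n d) = 1 := by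
    intro k
    rw [integral_finsetSum _ fun i _ => hi k i]
    simp_rw [integral_const_mul, hv]
    simp [hn0]
  simp [this]

lemma aux_logdet (n d : ℕ) (hd : 1 ≤ d) (hn : d + 1 ≤ n) :
    Integrable (fun Y => Real.log (empCov n d Y).det) (stdGaussianSample n d) ∧
    ∫ Y, Real.log (empCov n d Y).det ∂(stdGaussianSample n d) =
      - (d * Real.log n) + ∑ k ∈ Finset.range d,
        (Real.log 2 + digamma (((n : ℝ) - 1 - k) / 2)) := by
  have hfr := aux_finrank n (by omega)
  obtain ⟨h1, h2, h3⟩ := aux_wishart (E := auxF n) d (by omega)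
  have hmp := aux_mp_cols n d
  have hn0 : (n : ℝ) ≠ 0 := by
    have : 0 < n := by omega
    positivity
  have hi : Integrable (fun Y => Real.log (Matrix.gram ℝ (auxCols n d Y)).det)
      (stdGaussianSample n d) := hmp.integrable_comp_of_integrable h2
  have hv : ∫ Y, Real.log (Matrix.gram ℝ (auxCols n d Y)).det ∂(stdGaussianSample n d) =
      ∑ k ∈ Finset.range d, (Real.log 2 + digamma (((n : ℝ) - 1 - k) / 2)) := by
    have h := h3
    rw [← hmp.map_eq, integral_map hmp.measurable.aemeasurable
      (by rw [hmp.map_eq]; exact h2.aestronglyMeasurable), hfr, Nat.cast_sub (by omega)] at h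
    simpa using h
  have hae : (fun Y => Real.log (empCov n d Y).det) =ᵐ[stdGaussianSample n d]
      fun Y => - (d * Real.log n) + Real.log (Matrix.gram ℝ (auxCols n d Y)).det := by
    have h4 : ∀ᵐ Y ∂(stdGaussianSample n d), LinearIndependent ℝ (auxCols n d Y) := by
      rw [← hmp.map_eq] at h1
      exact ae_of_ae_map hmp.measurable.aemeasurable h1
    filter_upwards [h4] with Y hY
    have hne := Matrix.det_gram_ne_zero_iff_linearIndependent.mpr hY
    rw [aux_empCov, Matrix.det_smul, Fintype.card_fin,
      Real.log_mul (pow_ne_zero _ (inv_ne_zero hn0)) hne, Real.log_pow, Real.log_inv]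
    ring
  have : IsProbabilityMeasure (stdGaussianSample n d) := by
    unfold stdGaussianSample; infer_instance
  refine ⟨((integrable_const _).add hi).congr hae.symm, ?_⟩
  rw [integral_congr_ae hae, integral_add (integrable_const _) hi, hv]
  simp

end FinalPart

theorem reverse_KL_unknown_mean_closed_form (d n : ℕ) (hd : 1 ≤ d) (hn : d + 1 ≤ n) :
    ∫ Y, (1 / 2) * ((empCov n d Y).trace
        + (∑ k : Fin d, (sampleMean n d Y k) ^ 2)
        - d - Real.log (empCov n d Y).det) ∂(stdGaussianSample n d)
      = (1 / 2) * (d * Real.log (n / 2)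
          - ∑ j ∈ Finset.Icc 1 d, digamma (((n : ℝ) - j) / 2)) := by
  have : IsProbabilityMeasure (stdGaussianSample n d) := by
    unfold stdGaussianSample; infer_instance
  obtain ⟨t1, t2⟩ := aux_trace_integral n d (by omega)
  obtain ⟨l1, l2⟩ := aux_logdet n d hd hn
  have hn0 : (n : ℝ) ≠ 0 := by
    have : 0 < n := by omega
    positivity
  have t3 : Integrable (fun Y => (empCov n d Y).trace + (∑ k : Fin d, (sampleMean n d Y k) ^ 2)
      - (d : ℝ)) (stdGaussianSample n d) := t1.sub (integrable_const _)
  rw [integral_const_mul, integral_sub t3 l1,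
    integral_sub t1 (integrable_const _), t2, l2, Real.log_div hn0 two_ne_zero]
  have hs : ∑ j ∈ Finset.Icc 1 d, digamma (((n : ℝ) - j) / 2)
      = ∑ k ∈ Finset.range d, digamma (((n : ℝ) - 1 - k) / 2) := by
    rw [← Finset.Ico_add_one_right_eq_Icc, Finset.sum_Ico_eq_sum_range]
    refine Finset.sum_congr (by simp) fun k _ => ?_
    congr 1
    push_cast
    ring
  rw [hs, Finset.sum_add_distrib]
  simp
  ring
end
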